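/- Let n ≥ 1 and let F, G ∈ C_c^∞(ℝ^{2n}). Then −min{F,G} = liminf of (−min{F',G'}) as F',G' → F,G in the uniform norm. Precisely, the nontrivial inequality is: for every ε > 0 there exists δ > 0 such that every pair F', G' ∈ C_c^∞(ℝ^{2n}) with ‖F' − F‖ < δ and ‖G' − G‖ < δ satisfies min{F',G'} < min{F,G} + ε. -/

import Mathlib

/-- The phase space `ℝ^{2n} = ℝ^n × ℝ^n` with coordinates `(p, q)`. -/
abbrev Phase (n : ℕ) := (Fin n → ℝ) × (Fin n → ℝ)

/-- Partial derivative `∂F/∂p_i`. -/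
noncomputable def pderivP {n : ℕ} (F : Phase n → ℝ) (i : Fin n) (x : Phase n) : ℝ :=
  fderiv ℝ F x (Pi.single i 1, 0)

/-- Partial derivative `∂F/∂q_i`. -/
noncomputable def pderivQ {n : ℕ} (F : Phase n → ℝ) (i : Fin n) (x : Phase n) : ℝ :=
  fderiv ℝ F x (0, Pi.single i 1)

/-- The standard Poisson bracket
`{F,G} = Σ i, (∂F/∂q_i · ∂G/∂p_i − ∂F/∂p_i · ∂G/∂q_i)`. -/
noncomputable def poisson {n : ℕ} (F G : Phase n → ℝ) (x : Phase n) : ℝ :=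
  ∑ i : Fin n, (pderivQ F i x * pderivP G i x - pderivP F i x * pderivQ G i x)

/-- `F ∈ C_c^∞(ℝ^{2n})`: smooth and compactly supported. -/
def SmoothCpt {n : ℕ} (F : Phase n → ℝ) : Prop :=
  ContDiff ℝ (⊤ : ℕ∞) F ∧ HasCompactSupport F

/-- The uniform (C⁰) norm `‖F‖ = sup_x |F x|`. -/
noncomputable def unif {n : ℕ} (F : Phase n → ℝ) : ℝ := ⨆ x, |F x|

open MeasureTheory Polynomial in
/-- Lagrange interpolation of `t ↦ det (1 + t A)` at many nodes. -/
theorem br_det_interp {ι : Type*} [Fintype ι] [DecidableEq ι] (A : EuclideanSpace ℝ ι →L[ℝ] EuclideanSpace ℝ ι)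
    (v : ℕ → ℝ) (hv : Function.Injective v) :
    (1 + A).det = ∑ i ∈ Finset.range (Fintype.card ι + 1),
      (1 + v i • A).det * eval 1 (Lagrange.basis (Finset.range (Fintype.card ι + 1)) v i) := by
  classical
  let b := (EuclideanSpace.basisFun ι ℝ).toBasis
  let M : Matrix ι ι ℝ := LinearMap.toMatrix b b (A : EuclideanSpace ℝ ι →ₗ[ℝ] EuclideanSpace ℝ ι)
  let p : ℝ[X] := ((Polynomial.X : ℝ[X]) • M.map Polynomial.C + (1 : Matrix ι ι ℝ).map Polynomial.C).det
  have hp : ∀ t : ℝ, eval t p = (1 + t • A).det := by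
    intro t
    have h1 : (1 + t • A).det = (1 + t • M).det := by
      change LinearMap.det _ = _
      rw [← LinearMap.det_toMatrix b]
      congr 1
      change LinearMap.toMatrix b b (LinearMap.id + t • (A : EuclideanSpace ℝ ι →ₗ[ℝ] EuclideanSpace ℝ ι)) = _
      rw [map_add, map_smul, LinearMap.toMatrix_id]
    rw [h1]
    have : eval t p = (Polynomial.evalRingHom t) p := rfl
    rw [this, RingHom.map_det]
    congr 1
    ext i j
    simp [Matrix.add_apply, Matrix.one_apply, add_comm]
    split_ifs <;> simp [mul_comm]
  have hd : p.degree < ((Finset.range (Fintype.card ι + 1)).card : WithBot ℕ) := by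
    rw [Finset.card_range]
    refine lt_of_le_of_lt Polynomial.degree_le_natDegree ?_
    have := Polynomial.natDegree_det_X_add_C_le M (1 : Matrix ι ι ℝ)
    exact_mod_cast Nat.lt_succ_of_le this
  have := Lagrange.eq_interpolate (s := Finset.range (Fintype.card ι + 1)) (v := v) hv.injOn hd
  have h2 : eval 1 p = (1 + A).det := by simpa using hp 1
  rw [← h2]
  conv_lhs => rw [this]
  rw [Lagrange.interpolate_apply, eval_finsetSum]
  refine Finset.sum_congr rfl fun i _ => ?_
  rw [eval_mul, eval_C, hp]

/-- radial projection to the unit ball, 2-Lipschitz -/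
noncomputable def brProj {E : Type*} [NormedAddCommGroup E] [NormedSpace ℝ E] (R : ℝ) (x : E) : E :=
  (R / max R ‖x‖) • x

theorem brProj_of_le {E : Type*} [NormedAddCommGroup E] [NormedSpace ℝ E] {R : ℝ} (hR : 0 < R) {x : E}
    (hx : ‖x‖ ≤ R) : brProj R x = x := by
  simp [brProj, max_eq_left hx, hR.ne']

theorem brProj_norm_of_ge {E : Type*} [NormedAddCommGroup E] [NormedSpace ℝ E] {R : ℝ} (hR : 0 < R) {x : E}
    (hx : R ≤ ‖x‖) : ‖brProj R x‖ = R := by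
  have : 0 < ‖x‖ := lt_of_lt_of_le hR hx
  rw [brProj, norm_smul, max_eq_right hx, Real.norm_of_nonneg (by positivity)]
  field_simp

theorem brProj_norm_le {E : Type*} [NormedAddCommGroup E] [NormedSpace ℝ E] {R : ℝ} (hR : 0 < R) (x : E) :
    ‖brProj R x‖ ≤ R := by
  rcases le_total ‖x‖ R with h | h
  · rwa [brProj_of_le hR h]
  · exact (brProj_norm_of_ge hR h).le

theorem brProj_norm_le_self {E : Type*} [NormedAddCommGroup E] [NormedSpace ℝ E] {R : ℝ} (hR : 0 < R) (x : E) :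
    ‖brProj R x‖ ≤ ‖x‖ := by
  rcases le_total ‖x‖ R with h | h
  · rw [brProj_of_le hR h]
  · rw [brProj_norm_of_ge hR h]; exact h

theorem brProj_lip {E : Type*} [NormedAddCommGroup E] [NormedSpace ℝ E] {R : ℝ} (hR : 0 < R) (x y : E) :
    ‖brProj R x - brProj R y‖ ≤ 2 * ‖x - y‖ := by
  have hx : 0 < max R ‖x‖ := lt_max_of_lt_left hR
  have hy : 0 < max R ‖y‖ := lt_max_of_lt_left hR
  have key : brProj R x - brProj R y = (R / max R ‖x‖) • (x - y) +
      (R / max R ‖x‖ - R / max R ‖y‖) • y := by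
    simp only [brProj, smul_sub, sub_smul]; abel
  have h1 : |R / max R ‖x‖| ≤ 1 := by
    rw [abs_of_nonneg (by positivity), div_le_one hx]; exact le_max_left _ _
  have h2 : |R / max R ‖x‖ - R / max R ‖y‖| * ‖y‖ ≤ ‖x - y‖ := by
    have : R / max R ‖x‖ - R / max R ‖y‖ = (R / max R ‖x‖) * ((max R ‖y‖ - max R ‖x‖) / max R ‖y‖) := by
      field_simp
    rw [this, abs_mul, abs_div (max R ‖y‖ - max R ‖x‖), abs_of_pos hy]
    have h3 : |max R ‖y‖ - max R ‖x‖| ≤ ‖x - y‖ := by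
      have h4 := abs_max_sub_max_le_abs ‖y‖ ‖x‖ R
      rw [max_comm R ‖y‖, max_comm R ‖x‖]
      refine h4.trans ?_
      rw [abs_sub_comm]; exact abs_norm_sub_norm_le x y
    have h5 : ‖y‖ / max R ‖y‖ ≤ 1 := by rw [div_le_one hy]; exact le_max_right _ _
    calc _ = |R / max R ‖x‖| * (|max R ‖y‖ - max R ‖x‖| * (‖y‖ / max R ‖y‖)) := by ring
      _ ≤ 1 * (‖x - y‖ * 1) := by gcongr
      _ = _ := by ring
  rw [key]
  refine (norm_add_le _ _).trans ?_
  rw [norm_smul, norm_smul, Real.norm_eq_abs, Real.norm_eq_abs]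
  nlinarith [norm_nonneg (x - y)]

open MeasureTheory in
theorem br_no_retract {ι : Type*} [Fintype ι] [DecidableEq ι]
    (r : EuclideanSpace ℝ ι → EuclideanSpace ℝ ι) (hr : ContDiff ℝ 1 r)
    (h1 : ∀ x, ‖x‖ = 1 → r x = x) (h2 : ∀ x, ‖x‖ ≤ 1 → ‖r x‖ = 1) : False := by
  let E := EuclideanSpace ℝ ι
  set D : Set E := Metric.closedBall 0 1 with hD
  have hDc : IsCompact D := isCompact_closedBall _ _
  let k : E → E := fun x => r x - x
  have hk : ContDiff ℝ 1 k := hr.sub contDiff_id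
  have hkd : ∀ x, HasFDerivAt k (fderiv ℝ k x) x := fun x =>
    (hk.differentiable one_ne_zero x).hasFDerivAt
  have hkc : Continuous (fderiv ℝ k) := hk.continuous_fderiv one_ne_zero
  obtain ⟨C, hC⟩ := hDc.exists_bound_of_continuousOn hkc.continuousOn
  have hC0 : 0 ≤ C := (norm_nonneg _).trans (hC 0 (by simp [hD]))
  have hlip : ∀ x ∈ D, ∀ y ∈ D, ‖k x - k y‖ ≤ C * ‖x - y‖ := fun x hx y hy =>
    Convex.norm_image_sub_le_of_norm_fderiv_le (fun z _ => (hkd z).differentiableAt) hC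
      (convex_closedBall _ _) hy hx
  have hpos : ∀ᶠ t in nhds (0 : ℝ), ∀ x ∈ D, 0 < (1 + t • fderiv ℝ k x).det := by
    refine hDc.eventually_forall_of_forall_eventually fun x _ => ?_
    have hc : Continuous fun z : ℝ × E => (1 + z.1 • fderiv ℝ k z.2).det :=
      ContinuousLinearMap.continuous_det.comp (by fun_prop)
    refine hc.continuousAt.eventually_const_lt ?_
    simp [ContinuousLinearMap.det]
  obtain ⟨t₀, ht₀, hpos⟩ := Metric.eventually_nhds_iff.1 hpos
  -- small t
  have hsmall : ∀ t : ℝ, 0 ≤ t → t < t₀ → t * (2 * C + 1) < 1 →  t ≤ 1 →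
      ∫ x in D, (1 + t • fderiv ℝ k x).det = volume.real D := by
    intro t ht0 ht1 ht2 ht3
    let g : E → E := fun x => x + t • k x
    have hg : ∀ x, HasFDerivAt g (1 + t • fderiv ℝ k x) x := fun x =>
      (hasFDerivAt_id x).add ((hkd x).const_smul t)
    have hinj : Set.InjOn g D := by
      intro x hx y hy hxy
      have : x - y = t • (k y - k x) := by
        simp only [g] at hxy
        rw [smul_sub, sub_eq_sub_iff_add_eq_add]; rw [hxy]; abel
      have h3 : ‖x - y‖ ≤ t * (C * ‖x - y‖) := by
        conv_lhs => rw [this, norm_smul, Real.norm_of_nonneg ht0]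
        have := hlip y hy x hx
        rw [norm_sub_rev y x] at this
        gcongr
      have h4 : ‖x - y‖ = 0 := by nlinarith [norm_nonneg (x - y)]
      exact sub_eq_zero.1 (norm_eq_zero.1 h4)
    have himg : g '' D = D := by
      apply Set.Subset.antisymm
      · rintro _ ⟨x, hx, rfl⟩
        have : g x = (1 - t) • x + t • r x := by
          simp only [g, k, smul_sub, sub_smul, one_smul]; abel
        rw [this]
        have hx' : ‖x‖ ≤ 1 := by simpa [hD] using hx
        have : ‖(1 - t) • x + t • r x‖ ≤ 1 := by
          refine (norm_add_le _ _).trans ?_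
          rw [norm_smul, norm_smul, h2 x hx', Real.norm_of_nonneg ht0, Real.norm_of_nonneg (by linarith)]
          nlinarith [norm_nonneg x]
        simpa [hD] using this
      · intro y hy
        have hy' : ‖y‖ ≤ 1 := by simpa [hD] using hy
        let T : E → E := fun x => y - t • k (brProj 1 x)
        have hT : ContractingWith (Real.toNNReal (t * (2 * C))) T := by
          refine ⟨?_, LipschitzWith.of_dist_le_mul fun a b => ?_⟩
          · rw [Real.toNNReal_lt_one]; nlinarith
          · rw [Real.coe_toNNReal _ (by positivity), dist_eq_norm, dist_eq_norm]
            have : T a - T b = t • (k (brProj 1 b) - k (brProj 1 a)) := by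
              simp only [T, smul_sub]; abel
            rw [this, norm_smul, Real.norm_of_nonneg ht0]
            have h5 := hlip (brProj 1 b) (by simpa [hD] using brProj_norm_le one_pos b)
              (brProj 1 a) (by simpa [hD] using brProj_norm_le one_pos a)
            have h6 := brProj_lip one_pos b a
            rw [norm_sub_rev b a] at h6
            calc _ ≤ t * (C * (2 * ‖a - b‖)) := by
                  refine mul_le_mul_of_nonneg_left (h5.trans ?_) ht0
                  gcongr
              _ = _ := by ring
        have hfix := hT.fixedPoint_isFixedPt
        set x := ContractingWith.fixedPoint T hT
        have hx : y - t • k (brProj 1 x) = x := hfix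
        have hxD : ‖x‖ ≤ 1 := by
          by_contra! hcon
          have h7 := brProj_norm_of_ge one_pos hcon.le
          have h8 : k (brProj 1 x) = 0 := by simp only [k]; rw [h1 _ h7, sub_self]
          rw [h8, smul_zero, sub_zero] at hx
          rw [← hx] at hcon; linarith
        refine ⟨x, by simpa [hD] using hxD, ?_⟩
        rw [brProj_of_le one_pos hxD] at hx
        simp only [g]; nth_rewrite 1 [← hx]; abel
    have := integral_image_eq_integral_abs_det_fderiv_smul volume
      (Metric.isClosed_closedBall.measurableSet : MeasurableSet D)
      (fun x _ => (hg x).hasFDerivWithinAt) hinj (fun _ => (1 : ℝ))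
    rw [himg] at this
    simp only [integral_const, smul_eq_mul, mul_one, measureReal_restrict_apply_univ] at this
    rw [this]
    refine setIntegral_congr_fun Metric.isClosed_closedBall.measurableSet fun x hx => ?_
    exact (abs_of_pos (hpos (by simpa [abs_of_nonneg ht0] using ht1) x hx)).symm
  -- nodes
  obtain ⟨τ, hτ0, hτ1, hτ2, hτ3⟩ : ∃ τ : ℝ, 0 < τ ∧ τ < t₀ ∧ τ * (2 * C + 1) < 1 ∧ τ ≤ 1 := by
    refine ⟨min (t₀ / 2) (1 / (2 * (2 * C + 1))), by positivity, ?_, ?_, ?_⟩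
    · exact (min_le_left _ _).trans_lt (by linarith)
    · calc _ ≤ 1 / (2 * (2 * C + 1)) * (2 * C + 1) := by gcongr; exact min_le_right _ _
        _ < 1 := by field_simp; norm_num
    · refine (min_le_right _ _).trans ?_
      rw [div_le_one (by positivity)]; linarith
  let v : ℕ → ℝ := fun i => τ / (i + 1)
  have hv : Function.Injective v := by
    intro i j hij
    simp only [v] at hij
    have h3 : (i : ℝ) + 1 ≠ 0 := by positivity
    have h4 : (j : ℝ) + 1 ≠ 0 := by positivity
    field_simp at hij
    have : (i : ℝ) = j := by linarith
    exact_mod_cast this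
  have hvle : ∀ i, 0 ≤ v i ∧ v i ≤ τ := fun i => ⟨by positivity, div_le_self hτ0.le (by
    have : (0 : ℝ) ≤ i := by positivity
    linarith)⟩
  set S := Finset.range (Fintype.card ι + 1)
  have hIntD : ∀ t : ℝ, IntegrableOn (fun x => (1 + t • fderiv ℝ k x).det) D := by
    intro t
    refine ContinuousOn.integrableOn_compact hDc (Continuous.continuousOn ?_)
    exact ContinuousLinearMap.continuous_det.comp (by fun_prop)
  have hfin : ∫ x in D, (1 + fderiv ℝ k x).det = volume.real D := by
    have e1 : ∫ x in D, (1 + fderiv ℝ k x).det = ∫ x in D, ∑ i ∈ S,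
        (1 + v i • fderiv ℝ k x).det * Polynomial.eval 1 (Lagrange.basis S v i) := by
      refine integral_congr_ae (Filter.Eventually.of_forall fun x => ?_)
      exact br_det_interp _ v hv
    rw [e1, integral_finsetSum _ (fun i _ => (hIntD (v i)).mul_const _)]
    have e2 : ∀ i ∈ S, ∫ x in D, (1 + v i • fderiv ℝ k x).det * Polynomial.eval 1 (Lagrange.basis S v i)
        = volume.real D * Polynomial.eval 1 (Lagrange.basis S v i) := by
      intro i _
      rw [integral_mul_const, hsmall (v i) (hvle i).1 ((hvle i).2.trans_lt hτ1) ?_ ((hvle i).2.trans hτ3)]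
      refine lt_of_le_of_lt ?_ hτ2
      have := (hvle i).2
      gcongr
    rw [Finset.sum_congr rfl e2, ← Finset.mul_sum, ← Polynomial.eval_finsetSum,
      Lagrange.sum_basis hv.injOn (by simp [S]), Polynomial.eval_one, mul_one]
  -- degenerate
  have hzero : ∀ x ∈ Metric.ball (0 : E) 1, (1 + fderiv ℝ k x).det = 0 := by
    intro x hx
    have hx' : ‖x‖ < 1 := by simpa using hx
    have hrd : HasFDerivAt r (1 + fderiv ℝ k x) x := by
      have := (hasFDerivAt_id x).add (hkd x)
      refine this.congr_of_eventuallyEq (Filter.Eventually.of_forall fun y => ?_)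
      simp [k]
    set A := 1 + fderiv ℝ k x
    have hperp : ∀ ξ, inner ℝ (r x) (A ξ) = 0 := by
      intro ξ
      have hd := hrd.norm_sq
      have hcst : (fun y => ‖r y‖ ^ 2) =ᶠ[nhds x] fun _ => (1 : ℝ) := by
        filter_upwards [Metric.isOpen_ball.mem_nhds hx] with y hy
        rw [h2 y (by simpa using (Metric.mem_ball.1 hy).le)]; norm_num
      have h0 := hd.unique ((hasFDerivAt_const (1 : ℝ) x).congr_of_eventuallyEq hcst)
      have := congrArg (fun L : E →L[ℝ] ℝ => L ξ) h0
      simpa using this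
    by_contra hne
    have hsurj : Function.Surjective A := by
      have hu : IsUnit (LinearMap.det (A : E →ₗ[ℝ] E)) := isUnit_iff_ne_zero.2 hne
      exact (LinearEquiv.ofIsUnitDet (f := (A : E →ₗ[ℝ] E)) (v := (EuclideanSpace.basisFun ι ℝ).toBasis)
        (v' := (EuclideanSpace.basisFun ι ℝ).toBasis) (by rwa [LinearMap.det_toMatrix])).surjective
    obtain ⟨ξ, hξ⟩ := hsurj (r x)
    have := hperp ξ
    rw [hξ, real_inner_self_eq_norm_sq, h2 x hx'.le] at this
    norm_num at this
  have hz : ∫ x in D, (1 + fderiv ℝ k x).det = 0 := by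
    have hcl : IsClosed {x : E | (1 + fderiv ℝ k x).det = 0} :=
      isClosed_eq (ContinuousLinearMap.continuous_det.comp (by fun_prop)) continuous_const
    have hsub := closure_minimal (s := Metric.ball (0 : E) 1) hzero hcl
    rw [closure_ball (0 : E) one_ne_zero] at hsub
    rw [setIntegral_congr_fun Metric.isClosed_closedBall.measurableSet hsub]; simp
  have hvol : 0 < volume.real D := by
    rw [measureReal_def]
    refine ENNReal.toReal_pos ?_ hDc.measure_lt_top.ne
    exact (Metric.measure_closedBall_pos volume (0 : E) one_pos).ne'
  linarith

/-- A `C^1` map equal to the identity outside a ball has a zero. -/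
theorem br_zero {ι : Type*} [Fintype ι] [DecidableEq ι]
    (g : EuclideanSpace ℝ ι → EuclideanSpace ℝ ι) (hg : ContDiff ℝ 1 g) (R : ℝ) (hR : 0 < R)
    (h1 : ∀ x, ‖x‖ = R → g x = x) : ∃ x, g x = 0 := by
  by_contra! hne
  have hne' : ∀ x, g (R • x) ≠ 0 := fun x => hne _
  refine br_no_retract (fun x => ‖g (R • x)‖⁻¹ • g (R • x)) ?_ ?_ ?_
  · have : ContDiff ℝ 1 fun x : EuclideanSpace ℝ ι => g (R • x) := hg.comp (contDiff_const_smul R)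
    exact ((this.norm ℝ hne').inv (fun x => norm_ne_zero_iff.2 (hne' x))).smul this
  · intro x hx
    have : ‖R • x‖ = R := by rw [norm_smul, hx, Real.norm_of_nonneg hR.le, mul_one]
    rw [h1 _ this, this, smul_smul, inv_mul_cancel₀ hR.ne', one_smul]
  · intro x _
    rw [norm_smul, norm_inv, norm_norm, inv_mul_cancel₀ (norm_ne_zero_iff.2 (hne' x))]

theorem br_fixed_C1 {ι : Type*} [Fintype ι] [DecidableEq ι]
    (f : EuclideanSpace ℝ ι → EuclideanSpace ℝ ι) (hf : ContDiff ℝ 1 f) (M : ℝ) (hM : 0 ≤ M)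
    (hb : ∀ x, ‖f x‖ ≤ M) : ∃ x, f x = x := by
  let χ : ContDiffBump (0 : EuclideanSpace ℝ ι) := ⟨M + 1, M + 2, by linarith, by linarith⟩
  obtain ⟨x, hx⟩ := br_zero (fun x => x - χ x • f x) (contDiff_id.sub (χ.contDiff.smul hf)) (M + 2)
    (by linarith) (by
      intro x hx
      have : χ x = 0 := χ.zero_of_le_dist (by simp [χ, hx])
      simp [this])
  have hx' : x = χ x • f x := sub_eq_zero.1 hx
  have hn : ‖x‖ ≤ M := by
    rw [hx', norm_smul, Real.norm_of_nonneg χ.nonneg]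
    calc _ ≤ 1 * M := mul_le_mul χ.le_one (hb x) (norm_nonneg _) zero_le_one
      _ = M := one_mul _
  have : χ x = 1 := χ.one_of_mem_closedBall (by simp [χ]; linarith)
  refine ⟨x, ?_⟩
  rw [this, one_smul] at hx'
  exact hx'.symm

/-- Brouwer: bounded continuous self-maps have fixed points. -/
theorem br_fixed {ι : Type*} [Fintype ι] [DecidableEq ι]
    (f : EuclideanSpace ℝ ι → EuclideanSpace ℝ ι) (hf : Continuous f) (M : ℝ) (hM : 0 ≤ M)
    (hb : ∀ x, ‖f x‖ ≤ M) : ∃ x, f x = x := by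
  have happ : ∀ ε : ℝ, 0 < ε → ∃ x, ‖f x - x‖ ≤ ε ∧ ‖x‖ ≤ M + ε := by
    intro ε hε
    obtain ⟨g, hg1, hg2⟩ : ∃ g : EuclideanSpace ℝ ι → EuclideanSpace ℝ ι, ContDiff ℝ 1 g ∧
        ∀ x, ‖g x - f x‖ ≤ ε := by
      obtain ⟨g, hg, hga, -⟩ := hf.exists_contDiff_approx 1 (ε := fun _ => ε) continuous_const (fun _ => hε)
      refine ⟨g, hg.of_le le_rfl, fun x => ?_⟩
      have := (hga x).le
      rwa [dist_eq_norm] at this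
    have hgb : ∀ x, ‖g x‖ ≤ M + ε := fun x => by
      have := norm_add_le (g x - f x) (f x)
      rw [sub_add_cancel] at this
      linarith [hg2 x, hb x]
    obtain ⟨x, hx⟩ := br_fixed_C1 g hg1 (M + ε) (by linarith) hgb
    refine ⟨x, ?_, ?_⟩
    · have := hg2 x; rw [hx, norm_sub_rev] at this; exact this
    · have := hgb x; rwa [hx] at this
  have hcomp : IsCompact (Metric.closedBall (0 : EuclideanSpace ℝ ι) (M + 1)) := isCompact_closedBall _ _
  obtain ⟨x, hxK, hmin⟩ := hcomp.exists_isMinOn ⟨0, by simp; linarith⟩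
    (f := fun x => ‖f x - x‖) (by fun_prop)
  refine ⟨x, sub_eq_zero.1 (norm_eq_zero.1 (le_antisymm ?_ (norm_nonneg _)))⟩
  by_contra! hpos
  obtain ⟨y, hy1, hy2⟩ := happ (min 1 (‖f x - x‖ / 2)) (by positivity)
  have h3 := hmin (a := y) (by simp; linarith [min_le_left 1 (‖f x - x‖ / 2)])
  simp only [Set.mem_ofPred_eq] at h3
  linarith [min_le_right 1 (‖f x - x‖ / 2)]

theorem mm_arith (κ η s n₁ n₂ x₁ x₂ b₁ b₂ c₁ c₂ : ℝ) (hκ0 : 0 < κ) (hκ1 : κ ≤ 1 / 4) (hη : 0 < η)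
    (hs : η < s) (hs_def : s = n₁ + n₂) (i1 : c₁ ≥ b₁ - s / 8 * n₁) (i2 : c₂ ≥ b₂ - s / 8 * n₂)
    (l1 : 2 * x₁ + b₁ = n₁ ^ 2) (l2 : -2 * x₂ + b₂ = n₂ ^ 2) :
    -2 * κ * x₁ + κ ^ 2 * n₁ ^ 2 + 2 * κ * x₂ - κ ^ 2 * n₂ ^ 2 - κ * (c₁ + c₂) ≤ - (κ * η ^ 2 / 4) := by
  have k1 : -2 * x₁ + κ * n₁ ^ 2 + 2 * x₂ - κ * n₂ ^ 2 - (c₁ + c₂) ≤ - (η ^ 2 / 4) := by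
    have hq : s ^ 2 / 2 ≤ n₁ ^ 2 + n₂ ^ 2 := by
      rw [hs_def]; nlinarith [sq_nonneg (n₁ - n₂)]
    have hq1 : κ * n₁ ^ 2 ≤ 1 / 4 * n₁ ^ 2 := by gcongr
    have hq2 : η ^ 2 ≤ s ^ 2 := by gcongr
    have hq3 : 0 ≤ κ * n₂ ^ 2 := by positivity
    have hq4 : s / 8 * n₁ + s / 8 * n₂ = s ^ 2 / 8 := by rw [hs_def]; ring
    nlinarith [sq_nonneg n₂]
  have := mul_le_mul_of_nonneg_left k1 hκ0.le
  nlinarith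

theorem mm_core {ι : Type*} [Fintype ι] [DecidableEq ι]
    (b : EuclideanSpace ℝ ι × EuclideanSpace ℝ ι → ℝ)
    (β₁ β₂ : EuclideanSpace ℝ ι × EuclideanSpace ℝ ι → EuclideanSpace ℝ ι)
    (hb : Differentiable ℝ b)
    (hβ : ∀ w a c, fderiv ℝ b w (a, c) = inner ℝ (β₁ w) a + inner ℝ (β₂ w) c)
    (M B C : ℝ) (hM : ∀ w, |b w| ≤ M) (hB : ∀ w, b w ≤ B) (hC : 0 ≤ C)
    (hC₁ : ∀ w, ‖β₁ w‖ ≤ C) (hC₂ : ∀ w, ‖β₂ w‖ ≤ C)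
    (hu₁ : UniformContinuous β₁) (hu₂ : UniformContinuous β₂) (η : ℝ) (hη : 0 < η) :
    ∃ w : EuclideanSpace ℝ ι × EuclideanSpace ℝ ι,
      ‖(2:ℝ) • w.1 + β₁ w‖ + ‖-((2:ℝ) • w.2) + β₂ w‖ ≤ η ∧ ‖w.1‖ ^ 2 - ‖w.2‖ ^ 2 + b w ≤ B := by
  by_contra! hcon
  let A : EuclideanSpace ℝ ι × EuclideanSpace ℝ ι → ℝ := fun w => ‖w.1‖ ^ 2 - ‖w.2‖ ^ 2 + b w
  have hcon' : ∀ w, A w ≤ B → η < ‖(2:ℝ) • w.1 + β₁ w‖ + ‖-((2:ℝ) • w.2) + β₂ w‖ := by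
    intro w hw
    by_contra! h
    exact absurd hw (not_le.2 (hcon w h))
  obtain ⟨ρ₁, hρ₁, hρ₁'⟩ := Metric.uniformContinuous_iff.1 hu₁ (η / 8) (by positivity)
  obtain ⟨ρ₂, hρ₂, hρ₂'⟩ := Metric.uniformContinuous_iff.1 hu₂ (η / 8) (by positivity)
  obtain ⟨κ, hκ0, hκ1, hκ2⟩ : ∃ κ : ℝ, 0 < κ ∧ κ ≤ 1 / 4 ∧ κ * (16 * C + 1) ≤ min ρ₁ ρ₂ := by
    refine ⟨min (1 / 4) (min ρ₁ ρ₂ / (16 * C + 1)), by positivity, min_le_left _ _, ?_⟩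
    calc _ ≤ min ρ₁ ρ₂ / (16 * C + 1) * (16 * C + 1) := by gcongr; exact min_le_right _ _
      _ = _ := by field_simp
  let v₁ : EuclideanSpace ℝ ι × EuclideanSpace ℝ ι → EuclideanSpace ℝ ι := fun w => (2:ℝ) • w.1 + β₁ w
  let v₂ : EuclideanSpace ℝ ι × EuclideanSpace ℝ ι → EuclideanSpace ℝ ι := fun w => -((2:ℝ) • w.2) + β₂ w
  let T : EuclideanSpace ℝ ι × EuclideanSpace ℝ ι → EuclideanSpace ℝ ι × EuclideanSpace ℝ ι :=
    fun w => (w.1 - κ • v₁ w, w.2 - κ • v₂ w)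
  have hβ₁c := hu₁.continuous
  have hβ₂c := hu₂.continuous
  have hTc : Continuous T := by fun_prop
  have hdec : ∀ w, A w ≤ B → A (T w) ≤ A w - κ * η ^ 2 / 4 := by
    intro w hw
    have hs := hcon' w hw
    change η < ‖v₁ w‖ + ‖v₂ w‖ at hs
    set s := ‖v₁ w‖ + ‖v₂ w‖ with hs_def
    have hn1 := norm_nonneg (v₁ w)
    have hn2 := norm_nonneg (v₂ w)
    -- mean value
    have hmv : ∃ t ∈ Set.Ioo (0:ℝ) 1, b (T w) - b w =
        -κ * (inner ℝ (β₁ (w + t • (T w - w))) (v₁ w) + inner ℝ (β₂ (w + t • (T w - w))) (v₂ w)) := by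
      have hd : ∀ t : ℝ, HasDerivAt (fun t : ℝ => b (w + t • (T w - w)))
          (fderiv ℝ b (w + t • (T w - w)) (T w - w)) t := by
        intro t
        have h1 : HasDerivAt (fun t : ℝ => w + t • (T w - w)) (T w - w) t := by
          simpa using ((hasDerivAt_id t).smul_const (T w - w)).const_add w
        exact (hb _).hasFDerivAt.comp_hasDerivAt t h1
      obtain ⟨t, ht, h⟩ := exists_hasDerivAt_eq_slope _ _ (zero_lt_one' ℝ)
        (fun t _ => (hd t).continuousAt.continuousWithinAt) (fun t _ => hd t)
      refine ⟨t, ht, ?_⟩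
      have e : T w - w = (-κ • v₁ w, -κ • v₂ w) := by ext <;> simp [T]
      simp only [one_smul, zero_smul, add_zero, sub_zero, div_one, add_sub_cancel] at h
      rw [← h]
      conv_lhs => rw [show (fderiv ℝ b (w + t • (T w - w))) (T w - w) =
        (fderiv ℝ b (w + t • (T w - w))) (-κ • v₁ w, -κ • v₂ w) from by rw [← e]]
      rw [hβ, inner_smul_right, inner_smul_right]; ring
    obtain ⟨t, ht, hbT⟩ := hmv
    set ξ := w + t • (T w - w) with hξ
    have hω : ‖β₁ ξ - β₁ w‖ ≤ s / 8 ∧ ‖β₂ ξ - β₂ w‖ ≤ s / 8 := by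
      rcases le_total (16 * C) s with h | h
      · constructor
        · calc _ ≤ ‖β₁ ξ‖ + ‖β₁ w‖ := norm_sub_le _ _
            _ ≤ _ := by linarith [hC₁ ξ, hC₁ w]
        · calc _ ≤ ‖β₂ ξ‖ + ‖β₂ w‖ := norm_sub_le _ _
            _ ≤ _ := by linarith [hC₂ ξ, hC₂ w]
      · have hd : dist ξ w < min ρ₁ ρ₂ := by
          have e1 : ‖T w - w‖ ≤ κ * s := by
            have e : T w - w = (-κ • v₁ w, -κ • v₂ w) := by ext <;> simp [T]
            rw [e, Prod.norm_def]
            simp only [norm_smul, norm_neg, Real.norm_of_nonneg hκ0.le]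
            refine max_le ?_ ?_ <;> gcongr <;> linarith
          rw [dist_eq_norm, hξ, add_sub_cancel_left, norm_smul, Real.norm_of_nonneg ht.1.le]
          calc _ ≤ 1 * (κ * s) := by gcongr; exact ht.2.le
            _ < κ * (16 * C + 1) := by nlinarith
            _ ≤ _ := hκ2
        have h1 := hρ₁' (hd.trans_le (min_le_left _ _))
        have h2 := hρ₂' (hd.trans_le (min_le_right _ _))
        rw [dist_eq_norm] at h1 h2
        constructor <;> linarith
    have i1 : inner ℝ (β₁ ξ) (v₁ w) ≥ inner ℝ (β₁ w) (v₁ w) - s / 8 * ‖v₁ w‖ := by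
      have := neg_le_of_abs_le (abs_real_inner_le_norm (β₁ ξ - β₁ w) (v₁ w))
      rw [inner_sub_left] at this
      nlinarith [hω.1]
    have i2 : inner ℝ (β₂ ξ) (v₂ w) ≥ inner ℝ (β₂ w) (v₂ w) - s / 8 * ‖v₂ w‖ := by
      have := neg_le_of_abs_le (abs_real_inner_le_norm (β₂ ξ - β₂ w) (v₂ w))
      rw [inner_sub_left] at this
      nlinarith [hω.2]
    have j1 : ‖(T w).1‖ ^ 2 = ‖w.1‖ ^ 2 - 2 * κ * inner ℝ w.1 (v₁ w) + κ ^ 2 * ‖v₁ w‖ ^ 2 := by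
      simp only [T]
      rw [norm_sub_sq_real, inner_smul_right, norm_smul, Real.norm_of_nonneg hκ0.le]; ring
    have j2 : ‖(T w).2‖ ^ 2 = ‖w.2‖ ^ 2 - 2 * κ * inner ℝ w.2 (v₂ w) + κ ^ 2 * ‖v₂ w‖ ^ 2 := by
      simp only [T]
      rw [norm_sub_sq_real, inner_smul_right, norm_smul, Real.norm_of_nonneg hκ0.le]; ring
    have l1 : 2 * inner ℝ w.1 (v₁ w) + inner ℝ (β₁ w) (v₁ w) = ‖v₁ w‖ ^ 2 := by
      rw [← real_inner_self_eq_norm_sq]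
      conv_rhs => rw [show inner ℝ (v₁ w) (v₁ w) = inner ℝ ((2:ℝ) • w.1 + β₁ w) (v₁ w) from rfl]
      rw [inner_add_left, inner_smul_left]; simp
    have l2 : -2 * inner ℝ w.2 (v₂ w) + inner ℝ (β₂ w) (v₂ w) = ‖v₂ w‖ ^ 2 := by
      rw [← real_inner_self_eq_norm_sq]
      conv_rhs => rw [show inner ℝ (v₂ w) (v₂ w) = inner ℝ (-((2:ℝ) • w.2) + β₂ w) (v₂ w) from rfl]
      rw [inner_add_left, inner_neg_left, inner_smul_left]; simp
    have := mm_arith κ η s ‖v₁ w‖ ‖v₂ w‖ (inner ℝ w.1 (v₁ w)) (inner ℝ w.2 (v₂ w)) (inner ℝ (β₁ w) (v₁ w))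
      (inner ℝ (β₂ w) (v₂ w)) (inner ℝ (β₁ ξ) (v₁ w)) (inner ℝ (β₂ ξ) (v₂ w)) hκ0 hκ1 hη hs hs_def i1 i2 l1 l2
    simp only [A]; rw [j1, j2]; linarith
  have hiter : ∀ y : EuclideanSpace ℝ ι, ∀ k : ℕ, A (T^[k] (0, y)) ≤ B - k * (κ * η ^ 2 / 4) := by
    intro y k
    have hpos : 0 ≤ κ * η ^ 2 / 4 := by positivity
    induction k with
    | zero =>
      simp only [A, Function.iterate_zero, id, norm_zero]
      have := hB (0, y)
      push_cast
      nlinarith [sq_nonneg ‖y‖]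
    | succ k ih =>
      rw [Function.iterate_succ_apply']
      have hk : 0 ≤ (k:ℝ) * (κ * η ^ 2 / 4) := by positivity
      have := hdec _ (ih.trans (by linarith))
      push_cast
      linarith
  have hbd : ∀ k : ℕ, ∃ R : ℝ, 0 ≤ R ∧ ∀ y : EuclideanSpace ℝ ι,
      ‖(T^[k] (0, y)).2 - (1 + 2 * κ) ^ k • y‖ ≤ R := by
    intro k
    induction k with
    | zero => exact ⟨0, le_rfl, fun y => by simp⟩
    | succ k ih =>
      obtain ⟨R, hR0, hR⟩ := ih
      refine ⟨(1 + 2 * κ) * R + κ * C, by positivity, fun y => ?_⟩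
      rw [Function.iterate_succ_apply']
      set w := T^[k] (0, y)
      have e : (T w).2 - (1 + 2 * κ) ^ (k + 1) • y =
          (1 + 2 * κ) • (w.2 - (1 + 2 * κ) ^ k • y) - κ • β₂ w := by
        simp only [T, v₂]
        module
      rw [e]
      refine (norm_sub_le _ _).trans ?_
      rw [norm_smul, norm_smul, Real.norm_of_nonneg hκ0.le, Real.norm_of_nonneg (by positivity)]
      gcongr
      · exact hR y
      · exact hC₂ w
  obtain ⟨k, hk⟩ := exists_nat_gt ((B + M) / (κ * η ^ 2 / 4))
  rw [div_lt_iff₀ (by positivity)] at hk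
  obtain ⟨R, hR0, hR⟩ := hbd k
  have hc : 0 < (1 + 2 * κ) ^ k := by positivity
  obtain ⟨y, hy⟩ := br_fixed (fun y => y - ((1 + 2 * κ) ^ k)⁻¹ • (T^[k] (0, y)).2) (by
      have : Continuous (T^[k]) := hTc.iterate k
      fun_prop) (((1 + 2 * κ) ^ k)⁻¹ * R) (by positivity) (by
      intro y
      have e : y - ((1 + 2 * κ) ^ k)⁻¹ • (T^[k] (0, y)).2 =
          -(((1 + 2 * κ) ^ k)⁻¹ • ((T^[k] (0, y)).2 - (1 + 2 * κ) ^ k • y)) := by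
        rw [smul_sub, smul_smul, inv_mul_cancel₀ hc.ne', one_smul]; abel
      rw [e, norm_neg, norm_smul, Real.norm_of_nonneg (by positivity)]
      gcongr
      exact hR y)
  have hz : (T^[k] (0, y)).2 = 0 := by
    have h := sub_eq_self.1 hy
    exact (smul_eq_zero.1 h).resolve_left (inv_ne_zero hc.ne')
  have h1 := hiter y k
  simp only [A] at h1
  rw [hz, norm_zero] at h1
  have h2 := neg_le_of_abs_le (hM (T^[k] (0, y)))
  nlinarith [sq_nonneg ‖(T^[k] (0, y)).1‖]

theorem mm {ι : Type*} [Fintype ι] [DecidableEq ι]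
    (b : EuclideanSpace ℝ ι × EuclideanSpace ℝ ι → ℝ) (hb : Differentiable ℝ b)
    (M B C : ℝ) (hM : ∀ w, |b w| ≤ M) (hB : ∀ w, b w ≤ B)
    (hC : ∀ w, ‖fderiv ℝ b w‖ ≤ C) (hu : UniformContinuous (fderiv ℝ b)) (η : ℝ) (hη : 0 < η) :
    ∃ w : EuclideanSpace ℝ ι × EuclideanSpace ℝ ι,
      (∀ a c, |2 * inner ℝ w.1 a - 2 * inner ℝ w.2 c + fderiv ℝ b w (a, c)| ≤ η * (‖a‖ + ‖c‖)) ∧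
      ‖w.1‖ ^ 2 - ‖w.2‖ ^ 2 + b w ≤ B := by
  let W := EuclideanSpace ℝ ι
  let J₁ : ((W × W) →L[ℝ] ℝ) → W := fun ℓ => (InnerProductSpace.toDual ℝ W).symm (ℓ.comp (.inl ℝ W W))
  let J₂ : ((W × W) →L[ℝ] ℝ) → W := fun ℓ => (InnerProductSpace.toDual ℝ W).symm (ℓ.comp (.inr ℝ W W))
  have hl1 : ∀ ℓ ℓ', dist (J₁ ℓ) (J₁ ℓ') ≤ dist ℓ ℓ' := by
    intro ℓ ℓ'
    rw [(InnerProductSpace.toDual ℝ W).symm.dist_map, dist_eq_norm, dist_eq_norm,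
      ← ContinuousLinearMap.sub_comp]
    refine (ContinuousLinearMap.opNorm_comp_le _ _).trans ?_
    exact mul_le_of_le_one_right (norm_nonneg _) (ContinuousLinearMap.norm_inl_le_one ℝ W W)
  have hl2 : ∀ ℓ ℓ', dist (J₂ ℓ) (J₂ ℓ') ≤ dist ℓ ℓ' := by
    intro ℓ ℓ'
    rw [(InnerProductSpace.toDual ℝ W).symm.dist_map, dist_eq_norm, dist_eq_norm,
      ← ContinuousLinearMap.sub_comp]
    refine (ContinuousLinearMap.opNorm_comp_le _ _).trans ?_
    exact mul_le_of_le_one_right (norm_nonneg _) (ContinuousLinearMap.norm_inr_le_one ℝ W W)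
  have hJ1 : ∀ ℓ a, inner ℝ (J₁ ℓ) a = ℓ (a, 0) := fun ℓ a => by
    change inner ℝ ((InnerProductSpace.toDual ℝ W).symm (ℓ.comp (.inl ℝ W W))) a = _
    rw [InnerProductSpace.toDual_symm_apply]; simp
  have hJ2 : ∀ ℓ a, inner ℝ (J₂ ℓ) a = ℓ (0, a) := fun ℓ a => by
    change inner ℝ ((InnerProductSpace.toDual ℝ W).symm (ℓ.comp (.inr ℝ W W))) a = _
    rw [InnerProductSpace.toDual_symm_apply]; simp
  have z1 : J₁ 0 = 0 := by simp [J₁]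
  have z2 : J₂ 0 = 0 := by simp [J₂]
  obtain ⟨w, hw1, hw2⟩ := mm_core b (fun w => J₁ (fderiv ℝ b w)) (fun w => J₂ (fderiv ℝ b w)) hb
    (by
      intro w a c
      rw [hJ1, hJ2, ← map_add]; simp) M B C hM hB ((norm_nonneg _).trans (hC 0))
    (fun w => by
      have := hl1 (fderiv ℝ b w) 0
      rw [z1, dist_zero_right, dist_zero_right] at this; exact this.trans (hC w))
    (fun w => by
      have := hl2 (fderiv ℝ b w) 0
      rw [z2, dist_zero_right, dist_zero_right] at this; exact this.trans (hC w))
    ((LipschitzWith.of_dist_le_mul (K := 1) (f := J₁) (fun x y => by simpa using hl1 x y)).uniformContinuous.comp hu)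
    ((LipschitzWith.of_dist_le_mul (K := 1) (f := J₂) (fun x y => by simpa using hl2 x y)).uniformContinuous.comp hu) η hη
  refine ⟨w, fun a c => ?_, hw2⟩
  have e : 2 * inner ℝ w.1 a - 2 * inner ℝ w.2 c + fderiv ℝ b w (a, c) =
      inner ℝ ((2:ℝ) • w.1 + J₁ (fderiv ℝ b w)) a + inner ℝ (-((2:ℝ) • w.2) + J₂ (fderiv ℝ b w)) c := by
    rw [inner_add_left, inner_add_left, inner_neg_left, inner_smul_left, inner_smul_left]
    rw [hJ1, hJ2]
    have : fderiv ℝ b w (a, c) = fderiv ℝ b w (a, 0) + fderiv ℝ b w (0, c) := by simp [← map_add]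
    rw [this]
    simp; ring
  rw [e]
  refine (abs_add_le _ _).trans ?_
  have h1 := abs_real_inner_le_norm ((2:ℝ) • w.1 + J₁ (fderiv ℝ b w)) a
  have h2 := abs_real_inner_le_norm (-((2:ℝ) • w.2) + J₂ (fderiv ℝ b w)) c
  have n1 := norm_nonneg ((2:ℝ) • w.1 + J₁ (fderiv ℝ b w))
  have n2 := norm_nonneg (-((2:ℝ) • w.2) + J₂ (fderiv ℝ b w))
  have h3 : ‖(2:ℝ) • w.1 + J₁ (fderiv ℝ b w)‖ * ‖a‖ ≤ η * ‖a‖ := by gcongr; linarith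
  have h4 : ‖-((2:ℝ) • w.2) + J₂ (fderiv ℝ b w)‖ * ‖c‖ ≤ η * ‖c‖ := by gcongr; linarith
  linarith

/-- vector of p-derivatives -/
noncomputable def dP {n : ℕ} (K : Phase n → ℝ) (x : Phase n) : Fin n → ℝ := fun i => pderivP K i x
/-- vector of q-derivatives -/
noncomputable def dQ {n : ℕ} (K : Phase n → ℝ) (x : Phase n) : Fin n → ℝ := fun i => pderivQ K i x

/-- block coordinate -/
noncomputable def doX (N n : ℕ) (i : ℕ) : EuclideanSpace ℝ (Fin N × Fin n) →L[ℝ] (Fin n → ℝ) :=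
  if h : i < N then ContinuousLinearMap.pi fun k => EuclideanSpace.proj ((⟨i, h⟩ : Fin N), k) else 0

theorem doX_apply {N n i : ℕ} (h : i < N) (x : EuclideanSpace ℝ (Fin N × Fin n)) (k : Fin n) :
    doX N n i x k = x (⟨i, h⟩, k) := by
  simp [doX, h]

theorem doX_single {N n i j : ℕ} (h : j < N) (k : Fin n) :
    doX N n i (EuclideanSpace.single ((⟨j, h⟩ : Fin N), k) 1) = if i = j then Pi.single k 1 else 0 := by
  by_cases hi : i < N
  · ext l
    rw [doX_apply hi]
    by_cases hij : i = j
    · subst hij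
      simp [Pi.single_apply]
    · simp [hij]
  · have : i ≠ j := by omega
    simp [doX, hi, this]

theorem do_inner {N n : ℕ} (x a : EuclideanSpace ℝ (Fin N × Fin n)) :
    inner ℝ x a = ∑ i ∈ Finset.range N, doX N n i x ⬝ᵥ doX N n i a := by
  rw [PiLp.inner_apply, Fintype.sum_prod_type, Finset.sum_range]
  refine Finset.sum_congr rfl fun i _ => ?_
  rw [dotProduct]
  refine Finset.sum_congr rfl fun k _ => ?_
  rw [doX_apply i.2, doX_apply i.2]
  simp [mul_comm]

theorem disc_orbit {n : ℕ} (N : ℕ) (hN : 0 < N) (h : ℝ) (hh : 0 ≤ h) (K : ℕ → Phase n → ℝ)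
    (hK : ∀ j, ContDiff ℝ 1 (K j)) (hKs : ∀ j, HasCompactSupport (K j)) (κ : ℕ → ℝ)
    (hκ : ∀ j x, -κ j ≤ K j x) (η : ℝ) (hη : 0 < η) :
    ∃ P q : ℕ → Fin n → ℝ, q 0 = 0 ∧ ‖P N‖ ≤ η ∧
      (∀ j < N, ‖q (j + 1) - q j - h • dP (K j) (P (j + 1), q j)‖ ≤ η) ∧
      (∀ j < N, ‖P (j + 1) - P j + h • dQ (K j) (P (j + 1), q j)‖ ≤ η) ∧
      ∑ j ∈ Finset.range N, (P (j + 1) ⬝ᵥ (q (j + 1) - q j) - h * K j (P (j + 1), q j)) ≤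
        h * ∑ j ∈ Finset.range N, κ j := by
  let W := EuclideanSpace ℝ (Fin N × Fin n)
  let X := doX N n
  let cp : ℕ → (W × W) →L[ℝ] (Fin n → ℝ) := fun j =>
    (X j).comp (ContinuousLinearMap.fst ℝ W W + ContinuousLinearMap.snd ℝ W W)
  let cu : ℕ → (W × W) →L[ℝ] (Fin n → ℝ) := fun j =>
    (X j).comp (ContinuousLinearMap.fst ℝ W W - ContinuousLinearMap.snd ℝ W W)
  let cq : ℕ → (W × W) →L[ℝ] (Fin n → ℝ) := fun j => ∑ i ∈ Finset.range j, cu i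
  let ℓ : ℕ → (W × W) →L[ℝ] Phase n := fun j => (cp j).prod (cq j)
  let b : W × W → ℝ := fun w => -(h * ∑ j ∈ Finset.range N, K j (ℓ j w))
  have hKd : ∀ j x, HasFDerivAt (K j) (fderiv ℝ (K j) x) x := fun j x =>
    ((hK j).differentiable one_ne_zero x).hasFDerivAt
  have hbd : ∀ w, HasFDerivAt b (-(h • ∑ j ∈ Finset.range N, (fderiv ℝ (K j) (ℓ j w)).comp (ℓ j))) w := by
    intro w
    refine HasFDerivAt.neg ?_
    refine HasFDerivAt.const_mul ?_ h
    refine HasFDerivAt.fun_sum fun j _ => ?_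
    exact (hKd j (ℓ j w)).comp w (ℓ j).hasFDerivAt
  have hbf : fderiv ℝ b = fun w => -(h • ∑ j ∈ Finset.range N, (fderiv ℝ (K j) (ℓ j w)).comp (ℓ j)) :=
    funext fun w => (hbd w).fderiv
  have hKb : ∀ j, ∃ C, 0 ≤ C ∧ ∀ x, ‖K j x‖ ≤ C := fun j => by
    obtain ⟨C, hC⟩ := (hKs j).exists_bound_of_continuous (hK j).continuous
    exact ⟨C, (norm_nonneg _).trans (hC 0), hC⟩
  have hKb' : ∀ j, ∃ C, 0 ≤ C ∧ ∀ x, ‖fderiv ℝ (K j) x‖ ≤ C := fun j => by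
    obtain ⟨C, hC⟩ := ((hKs j).fderiv ℝ).exists_bound_of_continuous ((hK j).continuous_fderiv one_ne_zero)
    exact ⟨C, (norm_nonneg _).trans (hC 0), hC⟩
  have hKu : ∀ j, UniformContinuous (fderiv ℝ (K j)) := fun j =>
    ((hKs j).fderiv ℝ).uniformContinuous_of_continuous ((hK j).continuous_fderiv one_ne_zero)
  choose M hM0 hM using hKb
  choose M' hM0' hM' using hKb'
  obtain ⟨w, hw1, hw2⟩ := mm b (fun w => (hbd w).differentiableAt) (h * ∑ j ∈ Finset.range N, M j)
    (h * ∑ j ∈ Finset.range N, κ j) (h * ∑ j ∈ Finset.range N, M' j * ‖ℓ j‖)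
    (by
      intro w
      simp only [b]
      rw [abs_neg, abs_mul, abs_of_nonneg hh]
      refine mul_le_mul_of_nonneg_left ?_ hh
      exact (Finset.abs_sum_le_sum_abs _ _).trans (Finset.sum_le_sum fun j _ => hM j _))
    (by
      intro w
      simp only [b]
      rw [← mul_neg, ← Finset.sum_neg_distrib]
      refine mul_le_mul_of_nonneg_left ?_ hh
      exact Finset.sum_le_sum fun j _ => by linarith [hκ j (ℓ j w)])
    (by
      intro w
      rw [hbf]
      simp only []
      rw [norm_neg, norm_smul, Real.norm_of_nonneg hh]
      refine mul_le_mul_of_nonneg_left ?_ hh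
      refine (norm_sum_le _ _).trans (Finset.sum_le_sum fun j _ => ?_)
      refine (ContinuousLinearMap.opNorm_comp_le _ _).trans ?_
      gcongr
      exact hM' j _)
    (by
      rw [hbf]
      refine UniformContinuous.neg ?_
      refine UniformContinuous.const_smul ?_ h
      refine Finset.uniformContinuous_sum _ fun j _ => ?_
      have h1 := ((ContinuousLinearMap.compL ℝ (W × W) (Phase n) ℝ).flip (ℓ j)).uniformContinuous
      exact h1.comp ((hKu j).comp (ℓ j).uniformContinuous))
    (η / 2) (by positivity)
  -- test with arbitrary directions
  have test : ∀ δp δu : W, |(∑ i ∈ Finset.range N, (X i δp ⬝ᵥ cu i w + cp i w ⬝ᵥ X i δu))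
      - h * ∑ j ∈ Finset.range N, fderiv ℝ (K j) (ℓ j w) (X j δp, ∑ i ∈ Finset.range j, X i δu)|
      ≤ η / 2 * (‖δp‖ + ‖δu‖) := by
    intro δp δu
    have h1 := hw1 ((1/2 : ℝ) • (δp + δu)) ((1/2 : ℝ) • (δp - δu))
    have e1 : 2 * inner ℝ w.1 ((1/2 : ℝ) • (δp + δu)) - 2 * inner ℝ w.2 ((1/2 : ℝ) • (δp - δu)) =
        ∑ i ∈ Finset.range N, (X i δp ⬝ᵥ cu i w + cp i w ⬝ᵥ X i δu) := by
      have : ∑ i ∈ Finset.range N, (X i δp ⬝ᵥ cu i w + cp i w ⬝ᵥ X i δu) =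
          inner ℝ δp (w.1 - w.2) + inner ℝ (w.1 + w.2) δu := by
        rw [do_inner, do_inner, ← Finset.sum_add_distrib]
        rfl
      rw [this, inner_smul_right, inner_smul_right, inner_add_right, inner_sub_right, inner_sub_right,
        inner_add_left, real_inner_comm w.1 δp, real_inner_comm w.2 δp]
      ring
    have e2 : fderiv ℝ b w ((1/2 : ℝ) • (δp + δu), (1/2 : ℝ) • (δp - δu)) =
        - (h * ∑ j ∈ Finset.range N, fderiv ℝ (K j) (ℓ j w) (X j δp, ∑ i ∈ Finset.range j, X i δu)) := by
      rw [hbf]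
      have e3 : ∀ j, ℓ j ((1/2 : ℝ) • (δp + δu), (1/2 : ℝ) • (δp - δu)) =
          (X j δp, ∑ i ∈ Finset.range j, X i δu) := by
        intro j
        have a1 : (1/2 : ℝ) • (δp + δu) + (1/2 : ℝ) • (δp - δu) = δp := by module
        have a2 : (1/2 : ℝ) • (δp + δu) - (1/2 : ℝ) • (δp - δu) = δu := by module
        have b1 : cp j ((1/2 : ℝ) • (δp + δu), (1/2 : ℝ) • (δp - δu)) = X j δp := congrArg (X j) a1
        have b2 : ∀ i, cu i ((1/2 : ℝ) • (δp + δu), (1/2 : ℝ) • (δp - δu)) = X i δu :=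
          fun i => congrArg (X i) a2
        simp only [ℓ, ContinuousLinearMap.prod_apply, b1, cq, ContinuousLinearMap.sum_apply, b2]
      simp only [ContinuousLinearMap.neg_apply, ContinuousLinearMap.smul_apply,
        ContinuousLinearMap.sum_apply, ContinuousLinearMap.comp_apply, e3, smul_eq_mul]
    rw [e1, e2, ← sub_eq_add_neg] at h1
    refine h1.trans ?_
    refine mul_le_mul_of_nonneg_left ?_ (by positivity)
    rw [norm_smul, norm_smul, Real.norm_of_nonneg (by norm_num : (0:ℝ) ≤ 1/2)]
    linarith [norm_add_le δp δu, norm_sub_le δp δu]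
  have hqs : ∀ j, cq (j + 1) w - cq j w = cu j w := by
    intro j
    simp only [cq, Finset.sum_range_succ, ContinuousLinearMap.add_apply]; abel
  have hns : ∀ (j : ℕ) (hj : j < N) (k : Fin n), ‖(EuclideanSpace.single ((⟨j, hj⟩ : Fin N), k) 1 : W)‖ = 1 :=
    fun j hj k => by simp [W]
  let P : ℕ → Fin n → ℝ := fun j => match j with
    | 0 => cp 0 w + h • dQ (K 0) (cp 0 w, cq 0 w)
    | j + 1 => cp j w
  refine ⟨P, fun j => cq j w, ?_, ?_, ?_, ?_, ?_⟩
  · simp [cq]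
  · obtain ⟨m, rfl⟩ : ∃ m, N = m + 1 := ⟨N - 1, by omega⟩
    change ‖cp m w‖ ≤ η
    rw [pi_norm_le_iff_of_nonneg hη.le]
    intro k
    have t := test 0 (EuclideanSpace.single ((⟨m, by omega⟩ : Fin (m+1)), k) 1)
    rw [hns] at t
    have e1 : ∀ j ∈ Finset.range (m+1), fderiv ℝ (K j) (ℓ j w) (X j 0, ∑ i ∈ Finset.range j,
        X i (EuclideanSpace.single ((⟨m, by omega⟩ : Fin (m+1)), k) 1)) = 0 := by
      intro j hj
      rw [Finset.sum_eq_zero, map_zero]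
      · exact map_zero _
      · intro i hi
        rw [doX_single, if_neg]
        have := Finset.mem_range.1 hi; have := Finset.mem_range.1 hj; omega
    rw [Finset.sum_eq_zero e1] at t
    simp only [X, map_zero, doX_single, zero_dotProduct, zero_add, mul_zero, sub_zero, norm_zero] at t
    rw [Finset.sum_eq_single m (by intro i _ hi; simp [hi]) (by simp)] at t
    simp only [if_true, dotProduct_single_one] at t
    rw [Real.norm_eq_abs]
    linarith
  · intro j hj
    rw [hqs]
    change ‖cu j w - h • dP (K j) (cp j w, cq j w)‖ ≤ η
    rw [pi_norm_le_iff_of_nonneg hη.le]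
    intro k
    have t := test (EuclideanSpace.single ((⟨j, hj⟩ : Fin N), k) 1) 0
    rw [hns] at t
    simp only [X, map_zero, doX_single, dotProduct_zero, add_zero, norm_zero, Finset.sum_const_zero] at t
    rw [Finset.sum_eq_single j (by intro i _ hi; simp [hi]) (by simp [hj]),
      Finset.sum_eq_single j (by intro i _ hi; simp [hi]; exact map_zero _) (by simp [hj])] at t
    simp only [if_true, single_one_dotProduct] at t
    rw [Real.norm_eq_abs]
    simp only [Pi.sub_apply, Pi.smul_apply, smul_eq_mul, dP, pderivP]
    refine t.trans ?_
    linarith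
  · intro j hj
    cases j with
    | zero =>
      change ‖cp 0 w - (cp 0 w + h • dQ (K 0) (cp 0 w, cq 0 w)) + h • dQ (K 0) (cp 0 w, cq 0 w)‖ ≤ η
      rw [show cp 0 w - (cp 0 w + h • dQ (K 0) (cp 0 w, cq 0 w)) + h • dQ (K 0) (cp 0 w, cq 0 w) = 0 by abel]
      simpa using hη.le
    | succ i =>
      change ‖cp (i+1) w - cp i w + h • dQ (K (i+1)) (cp (i+1) w, cq (i+1) w)‖ ≤ η
      rw [pi_norm_le_iff_of_nonneg hη.le]
      intro k
      have hi : i < N := by omega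
      have t := test 0 (EuclideanSpace.single ((⟨i, hi⟩ : Fin N), k) 1 - EuclideanSpace.single ((⟨i+1, hj⟩ : Fin N), k) 1)
      have e1 : ∀ j, ∑ x ∈ Finset.range j, X x (EuclideanSpace.single ((⟨i, hi⟩ : Fin N), k) 1 -
          EuclideanSpace.single ((⟨i+1, hj⟩ : Fin N), k) 1) = if j = i + 1 then Pi.single k 1 else 0 := by
        intro j
        simp only [X, map_sub, doX_single, Finset.sum_sub_distrib, Finset.sum_ite_eq', Finset.mem_range]
        split_ifs <;> first | omega | simp
      have e0 : X = doX N n := rfl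
      simp only [e1] at t
      simp only [e0, map_zero, map_sub, doX_single, zero_dotProduct, dotProduct_sub, zero_add, norm_zero,
        Finset.sum_sub_distrib] at t
      rw [Finset.sum_eq_single i (by intro l _ hl; simp [hl]) (by simp [hi]),
        Finset.sum_eq_single (i+1) (by intro l _ hl; simp [hl]) (by simp [hj]),
        Finset.sum_eq_single (i+1) (by intro l _ hl; simp [hl]; exact map_zero _) (by simp [hj])] at t
      simp only [if_true, dotProduct_single_one] at t
      rw [Real.norm_eq_abs]
      simp only [Pi.sub_apply, Pi.add_apply, Pi.smul_apply, smul_eq_mul, dQ, pderivQ]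
      have hn2 : ‖(EuclideanSpace.single ((⟨i, hi⟩ : Fin N), k) 1 - EuclideanSpace.single ((⟨i+1, hj⟩ : Fin N), k) 1 : W)‖
          ≤ 2 := by
        refine (norm_sub_le _ _).trans ?_
        rw [hns, hns]; norm_num
      have t2 : η / 2 * ‖(EuclideanSpace.single ((⟨i, hi⟩ : Fin N), k) 1 - EuclideanSpace.single ((⟨i+1, hj⟩ : Fin N), k) 1 : W)‖
          ≤ η / 2 * 2 := by gcongr
      rw [← abs_neg]
      refine le_trans (le_of_eq ?_) (t.trans (t2.trans (by linarith)))
      congr 1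
      change -(cp (i+1) w k - cp i w k + h * fderiv ℝ (K (i+1)) (ℓ (i+1) w) (0, Pi.single k 1)) = _
      ring
  · have e : ‖w.1‖ ^ 2 - ‖w.2‖ ^ 2 = ∑ j ∈ Finset.range N, cp j w ⬝ᵥ cu j w := by
      have : ∑ j ∈ Finset.range N, cp j w ⬝ᵥ cu j w = inner ℝ (w.1 + w.2) (w.1 - w.2) := by
        rw [do_inner]; rfl
      rw [this, inner_sub_right, inner_add_left, inner_add_left, real_inner_self_eq_norm_sq,
        real_inner_self_eq_norm_sq, real_inner_comm w.1 w.2]; ring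
    simp only [hqs]
    rw [e] at hw2
    rw [Finset.sum_sub_distrib, ← Finset.mul_sum]
    exact hw2

/-- global flow of a vector field -/
def IsFlow {V : Type*} [NormedAddCommGroup V] [NormedSpace ℝ V] (X : V → V) (Φ : ℝ → V → V) : Prop :=
  (∀ v, Φ 0 v = v) ∧ ∀ v t, HasDerivAt (fun s => Φ s v) (X (Φ t v)) t

theorem lip_of_norm {V W : Type*} [NormedAddCommGroup V] [NormedAddCommGroup W] {X : V → W} {K : ℝ} (hK : 0 ≤ K)
    (hX : ∀ x y, ‖X x - X y‖ ≤ K * ‖x - y‖) : LipschitzWith (Real.toNNReal K) X :=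
  LipschitzWith.of_dist_le_mul fun x y => by
    rw [dist_eq_norm, dist_eq_norm, Real.coe_toNNReal _ hK]; exact hX x y

theorem gron2 {E : Type*} [NormedAddCommGroup E] [NormedSpace ℝ E] {f f' : ℝ → E} {δ K ε T : ℝ}
    (hf : ∀ t, HasDerivAt f (f' t) t) (h0 : ‖f 0‖ ≤ δ)
    (hb : ∀ t, |t| ≤ T → ‖f' t‖ ≤ K * ‖f t‖ + ε) {t : ℝ} (ht : |t| ≤ T) :
    ‖f t‖ ≤ gronwallBound δ K ε |t| := by
  rcases le_total 0 t with h | h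
  · rw [abs_of_nonneg h] at ht ⊢
    have := norm_le_gronwallBound_of_norm_deriv_right_le (f := f) (f' := f') (a := 0) (b := t) (δ := δ) (K := K)
      (ε := ε) (fun s _ => (hf s).continuousAt.continuousWithinAt) (fun s _ => (hf s).hasDerivWithinAt) h0
      (fun s hs => hb s (by rw [abs_of_nonneg hs.1]; linarith [hs.2])) t ⟨h, le_rfl⟩
    simpa using this
  · rw [abs_of_nonpos h] at ht ⊢
    have hg : ∀ s : ℝ, HasDerivAt (fun s => f (-s)) (-f' (-s)) s := fun s => by
      have := (hf (-s)).scomp s (hasDerivAt_neg s)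
      simpa [Function.comp_def] using this
    have := norm_le_gronwallBound_of_norm_deriv_right_le (f := fun s => f (-s)) (f' := fun s => -f' (-s))
      (a := 0) (b := -t) (δ := δ) (K := K)
      (ε := ε) (fun s _ => (hg s).continuousAt.continuousWithinAt) (fun s _ => (hg s).hasDerivWithinAt)
      (by simpa using h0)
      (fun s hs => by
        rw [norm_neg]; exact hb (-s) (by rw [abs_neg, abs_of_nonneg hs.1]; linarith [hs.2])) (-t) ⟨by linarith, le_rfl⟩
    simpa using this

theorem flow_exists {V : Type*} [NormedAddCommGroup V] [NormedSpace ℝ V] [CompleteSpace V] {X : V → V} {K L : ℝ}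
    (hK : 0 ≤ K) (hX : ∀ x y, ‖X x - X y‖ ≤ K * ‖x - y‖) (hL : ∀ x, ‖X x‖ ≤ L) :
    ∃ Φ : ℝ → V → V, IsFlow X Φ := by
  have hL0 : 0 ≤ L := (norm_nonneg _).trans (hL 0)
  have hlip := lip_of_norm hK hX
  have hloc : ∀ (v : V) (m : ℕ), ∃ α : ℝ → V, α 0 = v ∧
      ∀ t ∈ Set.Icc (-(m:ℝ) - 1) (m + 1), HasDerivWithinAt α (X (α t)) (Set.Icc (-(m:ℝ) - 1) (m + 1)) t := by
    intro v m
    have hm : (0:ℝ) ≤ m := by positivity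
    let t₀ : Set.Icc (-(m:ℝ) - 1) (m + 1) := ⟨0, by constructor <;> linarith⟩
    have hp : IsPicardLindelof (fun _ => X) t₀ v (Real.toNNReal (L * (m + 1))) 0 (Real.toNNReal L) (Real.toNNReal K) := by
      refine IsPicardLindelof.of_time_independent (fun x _ => ?_) hlip.lipschitzOnWith ?_
      · rw [Real.coe_toNNReal _ hL0]; exact hL x
      · rw [Real.coe_toNNReal _ hL0, Real.coe_toNNReal _ (by positivity)]
        simp [t₀, add_comm]
    exact hp.exists_eq_forall_mem_Icc_hasDerivWithinAt₀
  choose α hα0 hα using hloc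
  have hαd : ∀ (v : V) (m : ℕ), ∀ t ∈ Set.Ioo (-(m:ℝ) - 1) (m + 1), HasDerivAt (α v m) (X (α v m t)) t := fun v m t ht =>
    (hα v m t (Set.Ioo_subset_Icc_self ht)).hasDerivAt (Icc_mem_nhds ht.1 ht.2)
  have huniq : ∀ v (m k : ℕ), m ≤ k → ∀ t ∈ Set.Ioo (-(m:ℝ) - 1) (m + 1), α v m t = α v k t := by
    intro v m k hmk t ht
    have hmk' : (m:ℝ) ≤ k := by exact_mod_cast hmk
    have hm : (0:ℝ) ≤ m := by positivity
    have hsub : Set.Ioo (-(m:ℝ) - 1) (m + 1) ⊆ Set.Ioo (-(k:ℝ) - 1) (k + 1) := by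
      intro s hs; constructor <;> linarith [hs.1, hs.2]
    exact ODE_solution_unique_of_mem_Ioo (v := fun _ => X) (s := fun _ => Set.univ) (t₀ := 0)
      (fun s _ => hlip.lipschitzOnWith) (by constructor <;> linarith)
      (fun s hs => ⟨hαd v m s hs, trivial⟩) (fun s hs => ⟨hαd v k s (hsub hs), trivial⟩)
      ((hα0 v m).trans (hα0 v k).symm) ht
  refine ⟨fun t v => α v ⌈|t|⌉₊ t, fun v => hα0 v _, fun v t => ?_⟩
  have hin : ∀ s : ℝ, s ∈ Set.Ioo (-(⌈|s|⌉₊:ℝ) - 1) (⌈|s|⌉₊ + 1) := by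
    intro s
    have h1 := Nat.le_ceil |s|
    have h2 := neg_abs_le s
    have h3 := le_abs_self s
    constructor <;> linarith
  let m := ⌈|t|⌉₊ + 1
  have hm : t ∈ Set.Ioo (-(m:ℝ)) m := by
    have := hin t
    simp only [m]; push_cast
    constructor <;> linarith [this.1, this.2]
  have heq : ∀ s ∈ Set.Ioo (-(m:ℝ)) m, α v ⌈|s|⌉₊ s = α v m s := by
    intro s hs
    refine huniq v _ _ ?_ s (hin s)
    exact Nat.ceil_le.2 (abs_le.2 ⟨hs.1.le, hs.2.le⟩)
  have hev : (fun s => α v ⌈|s|⌉₊ s) =ᶠ[nhds t] α v m := by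
    filter_upwards [Ioo_mem_nhds hm.1 hm.2] with s hs using heq s hs
  have h1 := (hαd v m t (by constructor <;> linarith [hm.1, hm.2])).congr_of_eventuallyEq hev
  have h2 : α v m t = α v ⌈|t|⌉₊ t := (heq t hm).symm
  rw [h2] at h1
  exact h1

theorem IsFlow.unique {V : Type*} [NormedAddCommGroup V] [NormedSpace ℝ V] {X : V → V} {Φ : ℝ → V → V} {K : ℝ}
    (hΦ : IsFlow X Φ) (hK : 0 ≤ K) (hX : ∀ x y, ‖X x - X y‖ ≤ K * ‖x - y‖) {γ : ℝ → V} {v : V}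
    (hγ : ∀ t, HasDerivAt γ (X (γ t)) t) (h0 : γ 0 = v) (t : ℝ) : γ t = Φ t v := by
  have := ODE_solution_unique_univ (v := fun _ => X) (s := fun _ => Set.univ) (t₀ := 0) (f := γ)
    (g := fun s => Φ s v) (K := Real.toNNReal K)
    (fun s => (lip_of_norm hK hX).lipschitzOnWith) (fun s => ⟨hγ s, trivial⟩) (fun s => ⟨hΦ.2 v s, trivial⟩)
    (by rw [h0]; exact (hΦ.1 v).symm)
  exact congrFun this t

theorem IsFlow.add {V : Type*} [NormedAddCommGroup V] [NormedSpace ℝ V] {X : V → V} {Φ : ℝ → V → V} {K : ℝ}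
    (hΦ : IsFlow X Φ) (hK : 0 ≤ K) (hX : ∀ x y, ‖X x - X y‖ ≤ K * ‖x - y‖) (s t : ℝ) (v : V) :
    Φ (s + t) v = Φ s (Φ t v) := by
  refine hΦ.unique hK hX (γ := fun s => Φ (s + t) v) (fun s => ?_) (by simp) s
  exact (hΦ.2 v (s + t)).comp_add_const s t

theorem IsFlow.lip {V : Type*} [NormedAddCommGroup V] [NormedSpace ℝ V] {X : V → V} {Φ : ℝ → V → V} {K : ℝ}
    (hΦ : IsFlow X Φ) (hX : ∀ x y, ‖X x - X y‖ ≤ K * ‖x - y‖) (t : ℝ) (v w : V) :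
    ‖Φ t v - Φ t w‖ ≤ Real.exp (K * |t|) * ‖v - w‖ := by
  have := gron2 (f := fun s => Φ s v - Φ s w) (f' := fun s => X (Φ s v) - X (Φ s w)) (δ := ‖v - w‖) (K := K)
    (ε := 0) (T := |t|) (t := t) (fun s => (hΦ.2 v s).sub (hΦ.2 w s)) (by rw [hΦ.1, hΦ.1])
    (fun s _ => by rw [add_zero]; exact hX _ _) le_rfl
  rw [gronwallBound_ε0] at this
  linarith

theorem IsFlow.speed {V : Type*} [NormedAddCommGroup V] [NormedSpace ℝ V] {X : V → V} {Φ : ℝ → V → V} {L : ℝ}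
    (hΦ : IsFlow X Φ) (hL : ∀ x, ‖X x‖ ≤ L) (s t : ℝ) (v : V) :
    ‖Φ t v - Φ s v‖ ≤ L * |t - s| := by
  have := Convex.norm_image_sub_le_of_norm_hasDerivWithin_le (f := fun s => Φ s v) (s := Set.univ) (C := L)
    (f' := fun s => X (Φ s v)) (fun s _ => (hΦ.2 v s).hasDerivWithinAt) (fun s _ => hL _) convex_univ
    (Set.mem_univ s) (Set.mem_univ t)
  simpa using this

theorem taylor_lip {V W : Type*} [NormedAddCommGroup V] [NormedSpace ℝ V] [NormedAddCommGroup W] [NormedSpace ℝ W]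
    {X : V → W} {X' : V → V →L[ℝ] W} {K' : ℝ}
    (hd : ∀ x, HasFDerivAt X (X' x) x) (hK' : 0 ≤ K') (hX' : ∀ x y, ‖X' x - X' y‖ ≤ K' * ‖x - y‖) (a b : V) :
    ‖X b - X a - X' a (b - a)‖ ≤ K' * ‖b - a‖ ^ 2 := by
  have := Convex.norm_image_sub_le_of_norm_hasFDerivWithin_le' (f := X) (f' := X') (φ := X' a)
    (s := Metric.closedBall a ‖b - a‖) (C := K' * ‖b - a‖) (x := a) (y := b)
    (fun x _ => (hd x).hasFDerivWithinAt) (fun x hx => (hX' x a).trans (by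
      gcongr; rw [← dist_eq_norm]; exact hx)) (convex_closedBall _ _) (by simp) (by simp [dist_eq_norm])
  rw [pow_two, ← mul_assoc]; exact this

/-- `C¹` dependence and variational equation on a bounded time interval. -/
theorem IsFlow.var_loc {V : Type*} [NormedAddCommGroup V] [NormedSpace ℝ V] [CompleteSpace V]
    {X : V → V} {X' : V → V →L[ℝ] V}
    {Φ : ℝ → V → V} {K K' L : ℝ}
    (hΦ : IsFlow X Φ) (hK : 0 ≤ K) (hX : ∀ x y, ‖X x - X y‖ ≤ K * ‖x - y‖) (hL : ∀ x, ‖X x‖ ≤ L)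
    (hd : ∀ x, HasFDerivAt X (X' x) x) (hK' : 0 ≤ K') (hX' : ∀ x y, ‖X' x - X' y‖ ≤ K' * ‖x - y‖)
    (T : ℝ) (hT : 0 ≤ T) :
    ∃ M : ℝ → V → V →L[ℝ] V, (∀ v, M 0 v = 1) ∧ (∀ v t, |t| ≤ T → HasFDerivAt (Φ t) (M t v) v) ∧
      (∀ v t, |t| ≤ T → HasDerivAt (fun s => M s v) ((X' (Φ t v)).comp (M t v)) t) ∧
      Continuous (fun p : ℝ × V => M p.1 p.2) := by
  have hL0 : 0 ≤ L := (norm_nonneg _).trans (hL 0)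
  have hX'b : ∀ x, ‖X' x‖ ≤ K := fun x =>
    (hd x).le_of_lip' hK (Filter.Eventually.of_forall fun y => hX y x)
  let R := Real.exp (K * T)
  have hR : 0 < R := Real.exp_pos _
  let Y : V × (V →L[ℝ] V) → V × (V →L[ℝ] V) := fun p => (X p.1, (X' p.1).comp (brProj R p.2))
  have hY : ∀ x y, ‖Y x - Y y‖ ≤ (K + K' * R + 2 * K) * ‖x - y‖ := by
    intro x y
    have h1 : ‖x.1 - y.1‖ ≤ ‖x - y‖ := norm_fst_le (x - y)
    have h2 : ‖x.2 - y.2‖ ≤ ‖x - y‖ := norm_snd_le (x - y)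
    have hn := norm_nonneg (x - y)
    refine max_le ?_ ?_
    · calc ‖X x.1 - X y.1‖ ≤ K * ‖x.1 - y.1‖ := hX _ _
        _ ≤ K * ‖x - y‖ := by gcongr
        _ ≤ _ := by gcongr; nlinarith
    · change ‖(X' x.1).comp (brProj R x.2) - (X' y.1).comp (brProj R y.2)‖ ≤ _
      have e : (X' x.1).comp (brProj R x.2) - (X' y.1).comp (brProj R y.2) =
          (X' x.1 - X' y.1).comp (brProj R x.2) + (X' y.1).comp (brProj R x.2 - brProj R y.2) := by
        rw [ContinuousLinearMap.sub_comp, ContinuousLinearMap.comp_sub]; abel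
      rw [e]
      calc _ ≤ ‖X' x.1 - X' y.1‖ * ‖brProj R x.2‖ + ‖X' y.1‖ * ‖brProj R x.2 - brProj R y.2‖ :=
            (norm_add_le _ _).trans (add_le_add (ContinuousLinearMap.opNorm_comp_le _ _)
              (ContinuousLinearMap.opNorm_comp_le _ _))
        _ ≤ (K' * ‖x - y‖) * R + K * (2 * ‖x - y‖) := by
            gcongr
            · exact (hX' _ _).trans (by gcongr)
            · exact brProj_norm_le hR _
            · exact hX'b _
            · exact (brProj_lip hR _ _).trans (by gcongr)
        _ ≤ _ := by nlinarith
  have hYL : ∀ x, ‖Y x‖ ≤ L + K * R := by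
    intro x
    refine max_le ?_ ?_
    · exact (hL _).trans (le_add_of_nonneg_right (by positivity))
    · refine (ContinuousLinearMap.opNorm_comp_le _ _).trans ?_
      calc _ ≤ K * R := by
            gcongr
            · exact hX'b _
            · exact brProj_norm_le hR _
        _ ≤ _ := by linarith
  obtain ⟨Ψ, hΨ⟩ := flow_exists (by positivity) hY hYL
  let M : ℝ → V → V →L[ℝ] V := fun t v => (Ψ t (v, 1)).2
  have hfst : ∀ t v, (Ψ t (v, 1)).1 = Φ t v := by
    intro t v
    refine hΦ.unique hK hX (γ := fun s => (Ψ s (v, 1)).1) (fun s => ?_) ?_ t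
    · exact (hΨ.2 (v, 1) s).fst
    · simp only [hΨ.1]
  have hMd : ∀ v t, HasDerivAt (fun s => M s v) ((X' (Φ t v)).comp (brProj R (M t v))) t := by
    intro v t
    have := (hΨ.2 (v, 1) t).snd
    simp only [Y, hfst] at this
    exact this
  have hM0 : ∀ v, M 0 v = 1 := fun v => by simp only [M]; rw [hΨ.1]
  have hMb : ∀ v t, |t| ≤ T → ‖M t v‖ ≤ R := by
    intro v t ht
    have := gron2 (f := fun s => M s v) (δ := 1) (K := K) (ε := 0) (T := |t|) (t := t) (hMd v)
      (by rw [hM0]; exact ContinuousLinearMap.norm_id_le)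
      (fun s _ => by
        rw [add_zero]
        refine (ContinuousLinearMap.opNorm_comp_le _ _).trans ?_
        gcongr
        · exact hX'b _
        · exact brProj_norm_le_self hR _) le_rfl
    rw [gronwallBound_ε0, one_mul] at this
    refine this.trans ?_
    simp only [R]
    gcongr
  have hMd' : ∀ v t, |t| ≤ T → HasDerivAt (fun s => M s v) ((X' (Φ t v)).comp (M t v)) t := by
    intro v t ht
    have := hMd v t
    rwa [brProj_of_le hR (hMb v t ht)] at this
  have hMc : Continuous (fun p : ℝ × V => M p.1 p.2) := by
    refine Continuous.snd (f := fun p : ℝ × V => Ψ p.1 (p.2, 1)) ?_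
    rw [continuous_iff_continuousAt]
    rintro ⟨t, v⟩
    rw [ContinuousAt, tendsto_iff_norm_sub_tendsto_zero]
    set Q := K + K' * R + 2 * K with hQ
    have hQ0 : 0 ≤ Q := by positivity
    have hb : ∀ p : ℝ × V, ‖Ψ p.1 (p.2, 1) - Ψ t (v, 1)‖ ≤
        Real.exp (Q * |p.1|) * ‖p.2 - v‖ + (L + K * R) * |p.1 - t| := by
      intro p
      have h1 := hΨ.lip hY p.1 (p.2, 1) (v, 1)
      have h2 := hΨ.speed hYL t p.1 (v, 1)
      have h3 := norm_sub_le_norm_sub_add_norm_sub (Ψ p.1 (p.2, 1)) (Ψ p.1 (v, 1)) (Ψ t (v, 1))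
      have h4 : ‖((p.2, 1) : V × (V →L[ℝ] V)) - (v, 1)‖ = ‖p.2 - v‖ := by
        rw [Prod.mk_sub_mk, Prod.norm_mk, sub_self, norm_zero]; simp
      rw [h4] at h1
      linarith
    refine squeeze_zero (fun _ => norm_nonneg _) hb ?_
    have hc : Continuous fun p : ℝ × V => Real.exp (Q * |p.1|) * ‖p.2 - v‖ + (L + K * R) * |p.1 - t| := by
      fun_prop
    have := hc.tendsto (t, v)
    simpa using this
  refine ⟨M, hM0, fun v t ht => ?_, hMd', hMc⟩
  -- differentiability
  set c := K' * R ^ 2 with hc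
  have hest : ∀ ξ : V, ‖Φ t (v + ξ) - Φ t v - M t v ξ‖ ≤ gronwallBound 0 K 1 |t| * c * ‖ξ‖ ^ 2 := by
    intro ξ
    have hder : ∀ s, HasDerivAt (fun s => Φ s (v + ξ) - Φ s v - M s v ξ)
        (X (Φ s (v + ξ)) - X (Φ s v) - (X' (Φ s v)).comp (brProj R (M s v)) ξ) s := fun s =>
      ((hΦ.2 (v + ξ) s).sub (hΦ.2 v s)).sub ((hMd v s).clm_apply (hasDerivAt_const s ξ) |>.congr_deriv (by simp))
    have := gron2 (δ := 0) (K := K) (ε := c * ‖ξ‖ ^ 2) (T := T) (t := t) hder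
      (by simp [hΦ.1, hM0])
      (fun s hs => by
        rw [brProj_of_le hR (hMb v s hs)]
        have h1 := taylor_lip hd hK' hX' (Φ s v) (Φ s (v + ξ))
        have h2 : ‖Φ s (v + ξ) - Φ s v‖ ≤ R * ‖ξ‖ := by
          have := hΦ.lip hX s (v + ξ) v
          rw [add_sub_cancel_left] at this
          refine this.trans ?_
          simp only [R]
          gcongr
        have e : X (Φ s (v + ξ)) - X (Φ s v) - (X' (Φ s v)).comp (M s v) ξ =
            X' (Φ s v) (Φ s (v + ξ) - Φ s v - M s v ξ) +
            (X (Φ s (v + ξ)) - X (Φ s v) - X' (Φ s v) (Φ s (v + ξ) - Φ s v)) := by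
          simp only [map_sub, ContinuousLinearMap.comp_apply]; abel
        rw [e]
        refine (norm_add_le _ _).trans (add_le_add ?_ (h1.trans ?_))
        · exact ((X' (Φ s v)).le_opNorm _).trans (by gcongr; exact hX'b _)
        · rw [hc, mul_assoc, ← mul_pow]; gcongr) ht
    refine this.trans (le_of_eq ?_)
    by_cases hk : K = 0
    · subst hk; simp [gronwallBound_K0]; ring
    · simp [gronwallBound_of_K_ne_0 hk]; field_simp
  rw [hasFDerivAt_iff_isLittleO_nhds_zero]
  have hO : (fun ξ => Φ t (v + ξ) - Φ t v - M t v ξ) =O[nhds 0] fun ξ : V => ‖ξ‖ ^ 2 := by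
    refine Asymptotics.IsBigO.of_bound (gronwallBound 0 K 1 |t| * c) (Filter.Eventually.of_forall fun ξ => ?_)
    refine (hest ξ).trans (le_of_eq ?_)
    simp
  refine hO.trans_isLittleO ?_
  have := Asymptotics.isLittleO_norm_pow_id (E' := V) (n := 2) (by norm_num)
  exact this

theorem IsFlow.var {V : Type*} [NormedAddCommGroup V] [NormedSpace ℝ V] [CompleteSpace V]
    {X : V → V} {X' : V → V →L[ℝ] V}
    {Φ : ℝ → V → V} {K K' L : ℝ}
    (hΦ : IsFlow X Φ) (hK : 0 ≤ K) (hX : ∀ x y, ‖X x - X y‖ ≤ K * ‖x - y‖) (hL : ∀ x, ‖X x‖ ≤ L)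
    (hd : ∀ x, HasFDerivAt X (X' x) x) (hK' : 0 ≤ K') (hX' : ∀ x y, ‖X' x - X' y‖ ≤ K' * ‖x - y‖) :
    ContDiff ℝ 1 (fun p : ℝ × V => Φ p.1 p.2) ∧
    ∀ v ξ t, HasDerivAt (fun s => fderiv ℝ (Φ s) v ξ) (X' (Φ t v) (fderiv ℝ (Φ t) v ξ)) t := by
  have hXc : Continuous X := (lip_of_norm hK hX).continuous
  have hMdef : ∀ T : ℝ, 0 ≤ T → ∀ t, |t| < T → ∀ v, ∃ M : ℝ → V → V →L[ℝ] V,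
      (∀ᶠ p in nhds (t, v), HasFDerivAt (Φ p.1) (M p.1 p.2) p.2) ∧
      HasDerivAt (fun s => M s v) ((X' (Φ t v)).comp (M t v)) t ∧
      Continuous (fun p : ℝ × V => M p.1 p.2) := by
    intro T hT t ht v
    obtain ⟨M, h0, h1, h2, h3⟩ := hΦ.var_loc hK hX hL hd hK' hX' T hT
    refine ⟨M, ?_, h2 v t ht.le, h3⟩
    have : ∀ᶠ p : ℝ × V in nhds (t, v), |p.1| < T :=
      (continuous_abs.comp continuous_fst).continuousAt.eventually_lt_const ht
    filter_upwards [this] with p hp using h1 _ _ hp.le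
  have hdiff : ∀ t v, HasFDerivAt (Φ t) (fderiv ℝ (Φ t) v) v := by
    intro t v
    obtain ⟨M, h1, -⟩ := hMdef (|t| + 1) (by positivity) t (by linarith) v
    exact h1.self_of_nhds.differentiableAt.hasFDerivAt
  have hMc : Continuous (fun p : ℝ × V => fderiv ℝ (Φ p.1) p.2) := by
    rw [continuous_iff_continuousAt]
    rintro ⟨t, v⟩
    obtain ⟨M, h1, h2, h3⟩ := hMdef (|t| + 1) (by positivity) t (by linarith) v
    refine h3.continuousAt.congr ?_
    filter_upwards [h1] with p hp using hp.fderiv.symm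
  constructor
  · let f₁ : ℝ → V → ℝ →L[ℝ] V := fun t v => ContinuousLinearMap.toSpanSingleton ℝ (X (Φ t v))
    let f₂ : ℝ → V → V →L[ℝ] V := fun t v => fderiv ℝ (Φ t) v
    have hΦc : Continuous (fun p : ℝ × V => Φ p.1 p.2) := by
      rw [continuous_iff_continuousAt]
      rintro ⟨t, v⟩
      rw [ContinuousAt, tendsto_iff_norm_sub_tendsto_zero]
      have hb : ∀ p : ℝ × V, ‖Φ p.1 p.2 - Φ t v‖ ≤
          Real.exp (K * |p.1|) * ‖p.2 - v‖ + L * |p.1 - t| := by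
        intro p
        have h1 := hΦ.lip hX p.1 p.2 v
        have h2 := hΦ.speed hL t p.1 v
        have h3 := norm_sub_le_norm_sub_add_norm_sub (Φ p.1 p.2) (Φ p.1 v) (Φ t v)
        linarith
      refine squeeze_zero (fun _ => norm_nonneg _) hb ?_
      have hc : Continuous fun p : ℝ × V => Real.exp (K * |p.1|) * ‖p.2 - v‖ + L * |p.1 - t| := by
        fun_prop
      have := hc.tendsto (t, v)
      simpa using this
    have c1 : Continuous (fun p : ℝ × V => f₁ p.1 p.2) := by
      have : Continuous (fun p : ℝ × V => X (Φ p.1 p.2)) := hXc.comp hΦc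
      exact (ContinuousLinearMap.toSpanSingletonCLE (𝕜 := ℝ) (E := V)).continuous.comp this
    have hs : ∀ p : ℝ × V, HasStrictFDerivAt (fun p : ℝ × V => Φ p.1 p.2) ((f₁ p.1 p.2).coprod (f₂ p.1 p.2)) p := by
      intro p
      exact hasStrictFDerivAt_uncurry_coprod (f := Φ) (f₁ := f₁) (f₂ := f₂) (u := p)
        (Filter.Eventually.of_forall fun q => (hΦ.2 q.2 q.1).hasFDerivAt)
        (Filter.Eventually.of_forall fun q => hdiff q.1 q.2) c1.continuousAt hMc.continuousAt
    rw [contDiff_one_iff_hasFDerivAt]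
    refine ⟨_, ?_, fun p => (hs p).hasFDerivAt⟩
    exact (ContinuousLinearMap.coprodEquivL ℝ ).continuous.comp (c1.prodMk hMc)
  · intro v ξ t
    obtain ⟨M, h1, h2, h3⟩ := hMdef (|t| + 1) (by positivity) t (by linarith) v
    have h4 : ∀ᶠ s in nhds t, fderiv ℝ (Φ s) v = M s v := by
      have : Filter.Tendsto (fun s : ℝ => (s, v)) (nhds t) (nhds (t, v)) :=
        (Continuous.tendsto (by fun_prop) t)
      filter_upwards [this.eventually h1] with s hs using hs.fderiv
    have h5 := (h2.clm_apply (hasDerivAt_const t ξ)).congr_deriv (show _ = X' (Φ t v) (M t v ξ) by simp)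
    rw [h4.self_of_nhds]
    refine h5.congr_of_eventuallyEq ?_
    filter_upwards [h4] with s hs
    rw [hs]

/-- contactization of the phase space -/
abbrev CV (n : ℕ) := Phase n × ℝ

/-- contact Hamiltonian vector field -/
noncomputable def ell {n : ℕ} (H : Phase n → ℝ) (x : Phase n) : CV n :=
  ((-dQ H x, dP H x), x.1 ⬝ᵥ dP H x - H x)

noncomputable def alp {n : ℕ} (w ξ : CV n) : ℝ := ξ.2 - w.1.1 ⬝ᵥ ξ.1.2

noncomputable def Om {n : ℕ} (ξ η : Phase n) : ℝ := ξ.2 ⬝ᵥ η.1 - ξ.1 ⬝ᵥ η.2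

theorem lin_eq_dot {n : ℕ} (A : Phase n →L[ℝ] ℝ) (ξ : Phase n) :
    A ξ = ξ.1 ⬝ᵥ (fun i => A (Pi.single i 1, 0)) + ξ.2 ⬝ᵥ (fun i => A (0, Pi.single i 1)) := by
  obtain ⟨a, b⟩ := ξ
  have h1 : A (a, b) = A (a, 0) + A (0, b) := by rw [← map_add]; simp
  have h2 : A (a, 0) = ∑ i, a i * A (Pi.single i 1, 0) := by
    have := LinearMap.pi_apply_eq_sum_univ ((A.comp (ContinuousLinearMap.inl ℝ _ _)).toLinearMap) a
    have e : ∀ i : Fin n, (fun j => if i = j then (1:ℝ) else 0) = Pi.single i 1 := fun i => by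
      ext j; simp [Pi.single_apply, eq_comm]
    simp only [e] at this
    simpa using this
  have h3 : A (0, b) = ∑ i, b i * A (0, Pi.single i 1) := by
    have := LinearMap.pi_apply_eq_sum_univ ((A.comp (ContinuousLinearMap.inr ℝ _ _)).toLinearMap) b
    have e : ∀ i : Fin n, (fun j => if i = j then (1:ℝ) else 0) = Pi.single i 1 := fun i => by
      ext j; simp [Pi.single_apply, eq_comm]
    simp only [e] at this
    simpa using this
  rw [h1, h2, h3]; rfl

theorem fderiv_eq_dot {n : ℕ} (H : Phase n → ℝ) (x ξ : Phase n) :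
    fderiv ℝ H x ξ = ξ.1 ⬝ᵥ dP H x + ξ.2 ⬝ᵥ dQ H x := lin_eq_dot _ _

theorem Om_ell {n : ℕ} (H : Phase n → ℝ) (x η : Phase n) : Om (ell H x).1 η = fderiv ℝ H x η := by
  rw [fderiv_eq_dot]; simp only [Om, ell, neg_dotProduct]
  rw [dotProduct_comm (dP H x), dotProduct_comm (dQ H x)]; ring

theorem alp_ell {n : ℕ} (H : Phase n → ℝ) (w : CV n) : alp w (ell H w.1) = - H w.1 := by
  simp [alp, ell]

theorem poisson_eq {n : ℕ} (F G : Phase n → ℝ) (x : Phase n) : fderiv ℝ F x (ell G x).1 = poisson F G x := by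
  rw [fderiv_eq_dot]
  simp only [ell, poisson, dotProduct, dP, dQ, Pi.neg_apply, ← Finset.sum_add_distrib]
  exact Finset.sum_congr rfl fun i _ => by ring

theorem poisson_anti {n : ℕ} (F G : Phase n → ℝ) (x : Phase n) : poisson G F x = - poisson F G x := by
  simp only [poisson, ← Finset.sum_neg_distrib]
  exact Finset.sum_congr rfl fun i _ => by ring

theorem ell_char {n : ℕ} {H : Phase n → ℝ} {w ζ : CV n} (h1 : ∀ η, Om ζ.1 η = fderiv ℝ H w.1 η)
    (h2 : alp w ζ = - H w.1) : ζ = ell H w.1 := by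
  have e : ∀ η, Om ζ.1 η = Om (ell H w.1).1 η := fun η => by rw [h1, Om_ell]
  have e2 : ζ.1.2 = dP H w.1 := by
    ext i; have := e (Pi.single i 1, 0); simpa [Om, ell] using this
  have e1 : ζ.1.1 = - dQ H w.1 := by
    ext i; have := e (0, Pi.single i 1); simp [Om, ell] at this
    simp only [Pi.neg_apply]; linarith
  refine Prod.ext (Prod.ext e1 e2) ?_
  simp only [alp, e2] at h2
  simp only [ell]; linarith

theorem ell_sub {n : ℕ} {H K : Phase n → ℝ} {x : Phase n} (hH : DifferentiableAt ℝ H x) (hK : DifferentiableAt ℝ K x) :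
    ell (fun y => H y - K y) x = ell H x - ell K x := by
  have := ell_char (H := fun y => H y - K y) (w := (x, 0)) (ζ := ell H x - ell K x) (fun η => ?_) ?_
  · exact this.symm
  · rw [fderiv_fun_sub hH hK, ContinuousLinearMap.sub_apply, ← Om_ell, ← Om_ell]
    simp only [Om, Prod.fst_sub, Prod.snd_sub, sub_dotProduct]; ring
  · have a := alp_ell H (x, 0)
    have b := alp_ell K (x, 0)
    simp only [alp, Prod.fst_sub, Prod.snd_sub, dotProduct_sub] at *
    linarith

theorem hasDerivAt_dot {n : ℕ} {a b : ℝ → Fin n → ℝ} {a' b' : Fin n → ℝ} {t : ℝ}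
    (ha : HasDerivAt a a' t) (hb : HasDerivAt b b' t) :
    HasDerivAt (fun t => a t ⬝ᵥ b t) (a' ⬝ᵥ b t + a t ⬝ᵥ b') t := by
  rw [hasDerivAt_pi] at ha hb
  have := HasDerivAt.fun_sum (u := Finset.univ) fun i _ => (ha i).mul (hb i)
  simpa [dotProduct, Finset.sum_add_distrib] using this

theorem abs_dot_le {n : ℕ} (a b : Fin n → ℝ) : |a ⬝ᵥ b| ≤ n * ‖a‖ * ‖b‖ := by
  calc |a ⬝ᵥ b| ≤ ∑ i, |a i * b i| := Finset.abs_sum_le_sum_abs _ _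
    _ ≤ ∑ _i : Fin n, ‖a‖ * ‖b‖ := Finset.sum_le_sum fun i _ => by
        rw [abs_mul]
        gcongr
        · exact norm_le_pi_norm a i
        · exact norm_le_pi_norm b i
    _ = _ := by simp; ring

theorem norm_dP_le {n : ℕ} (H : Phase n → ℝ) (x : Phase n) : ‖dP H x‖ ≤ ‖fderiv ℝ H x‖ := by
  rw [pi_norm_le_iff_of_nonneg (norm_nonneg _)]
  intro i
  refine ((fderiv ℝ H x).le_opNorm _).trans ?_
  have : ‖((Pi.single i 1, 0) : Phase n)‖ ≤ 1 := by
    simp [Prod.norm_def, Pi.norm_single]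
  nlinarith [norm_nonneg (fderiv ℝ H x)]

theorem norm_dQ_le {n : ℕ} (H : Phase n → ℝ) (x : Phase n) : ‖dQ H x‖ ≤ ‖fderiv ℝ H x‖ := by
  rw [pi_norm_le_iff_of_nonneg (norm_nonneg _)]
  intro i
  refine ((fderiv ℝ H x).le_opNorm _).trans ?_
  have : ‖((0, Pi.single i 1) : Phase n)‖ ≤ 1 := by
    simp [Prod.norm_def, Pi.norm_single]
  nlinarith [norm_nonneg (fderiv ℝ H x)]

theorem contDiff_dP {n : ℕ} {H : Phase n → ℝ} (hH : ContDiff ℝ (⊤ : ℕ∞) H) : ContDiff ℝ 2 (dP H) := by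
  rw [contDiff_pi]
  intro i
  exact (hH.fderiv_right (m := 2) (by norm_cast)).clm_apply contDiff_const

theorem contDiff_dQ {n : ℕ} {H : Phase n → ℝ} (hH : ContDiff ℝ (⊤ : ℕ∞) H) : ContDiff ℝ 2 (dQ H) := by
  rw [contDiff_pi]
  intro i
  exact (hH.fderiv_right (m := 2) (by norm_cast)).clm_apply contDiff_const

theorem contDiff_ell {n : ℕ} {H : Phase n → ℝ} (hH : ContDiff ℝ (⊤ : ℕ∞) H) : ContDiff ℝ 2 (ell H) := by
  have h1 := contDiff_dP hH
  have h2 := contDiff_dQ hH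
  have h3 : ContDiff ℝ 2 H := hH.of_le (by norm_cast)
  have h4 : ContDiff ℝ 2 (fun x : Phase n => x.1 ⬝ᵥ dP H x) := by
    simp only [dotProduct]
    rw [contDiff_pi] at h1
    refine ContDiff.sum fun i _ => ContDiff.mul (by fun_prop) (h1 i)
  exact (h2.neg.prodMk h1).prodMk (h4.sub h3)

theorem cpt_ell {n : ℕ} {H : Phase n → ℝ} (hH : HasCompactSupport H) : HasCompactSupport (ell H) := by
  refine HasCompactSupport.intro hH fun x hx => ?_
  have h1 : fderiv ℝ H x = 0 := fderiv_of_notMem_tsupport ℝ hx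
  have h2 : H x = 0 := image_eq_zero_of_notMem_tsupport hx
  have h3 : dP H x = 0 := by ext i; simp [dP, pderivP, h1]
  have h4 : dQ H x = 0 := by ext i; simp [dQ, pderivQ, h1]
  simp [ell, h2, h3, h4]

/-- derivative of `ell H` -/
theorem fderiv_ell {n : ℕ} {H : Phase n → ℝ} (hH : ContDiff ℝ (⊤ : ℕ∞) H) (x ξ : Phase n) :
    fderiv ℝ (ell H) x ξ = ((-fderiv ℝ (dQ H) x ξ, fderiv ℝ (dP H) x ξ),
      ξ.1 ⬝ᵥ dP H x + x.1 ⬝ᵥ fderiv ℝ (dP H) x ξ - fderiv ℝ H x ξ) := by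
  have hc : HasDerivAt (fun s : ℝ => x + s • ξ) ξ 0 := by
    simpa using ((hasDerivAt_id (0:ℝ)).smul_const ξ).const_add x
  have key : ∀ {W : Type} [NormedAddCommGroup W] [NormedSpace ℝ W] {f : Phase n → W}, DifferentiableAt ℝ f x →
      HasDerivAt (fun s : ℝ => f (x + s • ξ)) (fderiv ℝ f x ξ) 0 := by
    intro W _ _ f hf
    have hf' : HasFDerivAt f (fderiv ℝ f x) (x + (0:ℝ) • ξ) := by simpa using hf.hasFDerivAt
    exact hf'.comp_hasDerivAt (0:ℝ) hc
  have k1 := key (((contDiff_ell hH).differentiable (by norm_num)) x)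
  have k2 := key (((contDiff_dP hH).differentiable (by norm_num)) x)
  have k3 := key (((contDiff_dQ hH).differentiable (by norm_num)) x)
  have k4 := key ((hH.differentiable (by norm_num)) x)
  have k5 := hasDerivAt_dot (key (f := Prod.fst) differentiableAt_fst) k2
  have k6 := (k3.neg.prodMk k2).prodMk (k5.sub k4)
  have := k1.unique k6
  rw [this]
  simp [fderiv_fst]

theorem fderiv2_symm {n : ℕ} {H : Phase n → ℝ} (hH : ContDiff ℝ (⊤ : ℕ∞) H) (x ξ η : Phase n) :
    η.1 ⬝ᵥ fderiv ℝ (dP H) x ξ + η.2 ⬝ᵥ fderiv ℝ (dQ H) x ξ =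
    ξ.1 ⬝ᵥ fderiv ℝ (dP H) x η + ξ.2 ⬝ᵥ fderiv ℝ (dQ H) x η := by
  have hd : DifferentiableAt ℝ (fderiv ℝ H) x :=
    ((hH.fderiv_right (m := 1) (by norm_cast)).differentiable (by norm_num)) x
  have e : ∀ ξ η : Phase n, η.1 ⬝ᵥ fderiv ℝ (dP H) x ξ + η.2 ⬝ᵥ fderiv ℝ (dQ H) x ξ =
      fderiv ℝ (fderiv ℝ H) x ξ η := by
    intro ξ η
    rw [lin_eq_dot (fderiv ℝ (fderiv ℝ H) x ξ) η]
    congr 2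
    · ext i
      have h1 := ((contDiff_dP hH).differentiable (by norm_num)) x
      have h2 := (hasFDerivAt_pi'.1 h1.hasFDerivAt) i
      have h3 := hd.hasFDerivAt.clm_apply (hasFDerivAt_const (Pi.single i 1, 0) x)
      have h4 := h2.unique h3
      have := congrArg (fun A => A ξ) h4
      simpa using this
    · ext i
      have h1 := ((contDiff_dQ hH).differentiable (by norm_num)) x
      have h2 := (hasFDerivAt_pi'.1 h1.hasFDerivAt) i
      have h3 := hd.hasFDerivAt.clm_apply (hasFDerivAt_const (0, Pi.single i 1) x)
      have h4 := h2.unique h3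
      have := congrArg (fun A => A ξ) h4
      simpa using this
  rw [e, e]
  have hs : IsSymmSndFDerivAt ℝ H x := (hH.contDiffAt).isSymmSndFDerivAt (by simp; norm_cast)
  exact hs ξ η

noncomputable def vf {n : ℕ} (H : Phase n → ℝ) (w : CV n) : CV n := ell H w.1

open Classical in
/-- the contact flow -/
noncomputable def fl {n : ℕ} (H : Phase n → ℝ) : ℝ → CV n → CV n :=
  if h : ∃ Φ, IsFlow (vf H) Φ then h.choose else fun _ w => w

theorem lipc {E W : Type*} [NormedAddCommGroup E] [NormedSpace ℝ E] [NormedAddCommGroup W] [NormedSpace ℝ W]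
    {f : E → W} (hf : HasCompactSupport f) (h : ContDiff ℝ 1 f) :
    ∃ K : ℝ, 0 ≤ K ∧ ∀ x y, ‖f x - f y‖ ≤ K * ‖x - y‖ := by
  obtain ⟨C, hC⟩ := h.lipschitzWith_of_hasCompactSupport hf (by norm_num)
  exact ⟨C, C.2, fun x y => by simpa [dist_eq_norm] using hC.dist_le_mul x y⟩

theorem vf_bounds {n : ℕ} {H : Phase n → ℝ} (hH : SmoothCpt H) :
    ∃ K L K' : ℝ, 0 ≤ K ∧ (∀ x y, ‖vf H x - vf H y‖ ≤ K * ‖x - y‖) ∧ (∀ x, ‖vf H x‖ ≤ L) ∧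
    (∀ w, HasFDerivAt (vf H) ((fderiv ℝ (ell H) w.1).comp (ContinuousLinearMap.fst ℝ _ _)) w) ∧ 0 ≤ K' ∧
    ∀ x y : CV n, ‖(fderiv ℝ (ell H) x.1).comp (ContinuousLinearMap.fst ℝ (Phase n) ℝ) -
      (fderiv ℝ (ell H) y.1).comp (ContinuousLinearMap.fst ℝ (Phase n) ℝ)‖ ≤ K' * ‖x - y‖ := by
  have hc := contDiff_ell hH.1
  have hs := cpt_ell hH.2
  obtain ⟨K, hK, h1⟩ := lipc hs (hc.of_le (by norm_num))
  obtain ⟨K', hK', h2⟩ := lipc (hs.fderiv ℝ) (hc.fderiv_right (m := 1) (by norm_num))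
  obtain ⟨L, hL⟩ := hs.exists_bound_of_continuous hc.continuous
  refine ⟨K, L, K', hK, fun x y => (h1 _ _).trans ?_, fun x => hL _, fun w => ?_, hK', fun x y => ?_⟩
  · gcongr; exact norm_fst_le (x - y)
  · exact ((hc.differentiable (by norm_num)) w.1).hasFDerivAt.comp w hasFDerivAt_fst
  · rw [← ContinuousLinearMap.sub_comp]
    refine (ContinuousLinearMap.opNorm_comp_le _ _).trans ?_
    have a := h2 x.1 y.1
    have b : ‖x.1 - y.1‖ ≤ ‖x - y‖ := norm_fst_le (x - y)
    have c := ContinuousLinearMap.norm_fst_le ℝ (Phase n) ℝ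
    calc _ ≤ (K' * ‖x - y‖) * 1 := by
          gcongr
          exact a.trans (by gcongr)
      _ = _ := mul_one _

theorem fl_isFlow {n : ℕ} {H : Phase n → ℝ} (hH : SmoothCpt H) : IsFlow (vf H) (fl H) := by
  obtain ⟨K, L, K', h0, h1, h2, h3, h4, h5⟩ := vf_bounds hH
  have h := flow_exists h0 h1 h2
  unfold fl
  rw [dif_pos h]
  exact h.choose_spec

theorem fl_zero {n : ℕ} {H : Phase n → ℝ} (hH : SmoothCpt H) (w : CV n) : fl H 0 w = w := (fl_isFlow hH).1 w

theorem fl_der {n : ℕ} {H : Phase n → ℝ} (hH : SmoothCpt H) (w : CV n) (t : ℝ) :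
    HasDerivAt (fun s => fl H s w) (ell H (fl H t w).1) t := (fl_isFlow hH).2 w t

theorem fl_unique {n : ℕ} {H : Phase n → ℝ} (hH : SmoothCpt H) {γ : ℝ → CV n} {v : CV n}
    (hγ : ∀ t, HasDerivAt γ (ell H (γ t).1) t) (h0 : γ 0 = v) (t : ℝ) : γ t = fl H t v := by
  obtain ⟨K, L, K', h0', h1, h2, h3, h4, h5⟩ := vf_bounds hH
  exact (fl_isFlow hH).unique h0' h1 hγ h0 t

theorem fl_add {n : ℕ} {H : Phase n → ℝ} (hH : SmoothCpt H) (s t : ℝ) (w : CV n) :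
    fl H (s + t) w = fl H s (fl H t w) := by
  obtain ⟨K, L, K', h0, h1, h2, h3, h4, h5⟩ := vf_bounds hH
  exact (fl_isFlow hH).add h0 h1 s t w

theorem fl_lip {n : ℕ} {H : Phase n → ℝ} (hH : SmoothCpt H) :
    ∃ K : ℝ, 0 ≤ K ∧ ∀ t v w, ‖fl H t v - fl H t w‖ ≤ Real.exp (K * |t|) * ‖v - w‖ := by
  obtain ⟨K, L, K', h0, h1, h2, h3, h4, h5⟩ := vf_bounds hH
  exact ⟨K, h0, fun t v w => (fl_isFlow hH).lip h1 t v w⟩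

theorem fl_speed {n : ℕ} {H : Phase n → ℝ} (hH : SmoothCpt H) :
    ∃ L : ℝ, 0 ≤ L ∧ ∀ t v, ‖fl H t v - v‖ ≤ L * |t| := by
  obtain ⟨K, L, K', h0, h1, h2, h3, h4, h5⟩ := vf_bounds hH
  refine ⟨L, (norm_nonneg _).trans (h2 0), fun t v => ?_⟩
  have := (fl_isFlow hH).speed h2 0 t v
  rwa [fl_zero hH, sub_zero] at this

theorem fl_contDiff {n : ℕ} {H : Phase n → ℝ} (hH : SmoothCpt H) :
    ContDiff ℝ 1 (fun p : ℝ × CV n => fl H p.1 p.2) := by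
  obtain ⟨K, L, K', h0, h1, h2, h3, h4, h5⟩ := vf_bounds hH
  exact ((fl_isFlow hH).var h0 h1 h2 h3 h4 h5).1

theorem fl_contDiff' {n : ℕ} {H : Phase n → ℝ} (hH : SmoothCpt H) (t : ℝ) : ContDiff ℝ 1 (fl H t) :=
  (fl_contDiff hH).comp (contDiff_const.prodMk contDiff_id)

theorem fl_var {n : ℕ} {H : Phase n → ℝ} (hH : SmoothCpt H) (w ξ : CV n) (t : ℝ) :
    HasDerivAt (fun s => fderiv ℝ (fl H s) w ξ) (fderiv ℝ (ell H) (fl H t w).1 (fderiv ℝ (fl H t) w ξ).1) t := by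
  obtain ⟨K, L, K', h0, h1, h2, h3, h4, h5⟩ := vf_bounds hH
  exact ((fl_isFlow hH).var h0 h1 h2 h3 h4 h5).2 w ξ t

theorem fl_eqv {n : ℕ} {H : Phase n → ℝ} (hH : SmoothCpt H) (t : ℝ) (w : CV n) (z : ℝ) :
    fl H t (w + (0, z)) = fl H t w + (0, z) := by
  refine (fl_unique hH (γ := fun s => fl H s w + (0, z)) (fun s => ?_) ?_ t).symm
  · simpa using (fl_der hH w s).add_const ((0, z) : CV n)
  · simp [fl_zero hH]

theorem const_of_der {E : Type*} [NormedAddCommGroup E] [NormedSpace ℝ E] {f : ℝ → E} (h : ∀ t, HasDerivAt f 0 t) (t : ℝ) : f t = f 0 :=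
  is_const_of_deriv_eq_zero (fun s => (h s).differentiableAt) (fun s => (h s).deriv) t 0

theorem fl_fderiv_zero {n : ℕ} {H : Phase n → ℝ} (hH : SmoothCpt H) (w ξ : CV n) : fderiv ℝ (fl H 0) w ξ = ξ := by
  have : fl H 0 = id := funext fun w => fl_zero hH w
  rw [this, fderiv_id]; rfl

theorem hd_fst {A B : Type*} [NormedAddCommGroup A] [NormedSpace ℝ A] [NormedAddCommGroup B] [NormedSpace ℝ B]
    {f : ℝ → A × B} {f' : A × B} {t : ℝ} (h : HasDerivAt f f' t) : HasDerivAt (fun s => (f s).1) f'.1 t := by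
  exact (hasFDerivAt_fst (𝕜 := ℝ) (p := f t)).comp_hasDerivAt t h

theorem hd_snd {A B : Type*} [NormedAddCommGroup A] [NormedSpace ℝ A] [NormedAddCommGroup B] [NormedSpace ℝ B]
    {f : ℝ → A × B} {f' : A × B} {t : ℝ} (h : HasDerivAt f f' t) : HasDerivAt (fun s => (f s).2) f'.2 t := by
  exact (hasFDerivAt_snd (𝕜 := ℝ) (p := f t)).comp_hasDerivAt t h

theorem fl_alp {n : ℕ} {H : Phase n → ℝ} (hH : SmoothCpt H) (t : ℝ) (w ξ : CV n) :
    alp (fl H t w) (fderiv ℝ (fl H t) w ξ) = alp w ξ := by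
  have := const_of_der (f := fun t => alp (fl H t w) (fderiv ℝ (fl H t) w ξ)) (fun t => ?_) t
  · refine this.trans ?_
    rw [ fl_fderiv_zero hH, fl_zero hH]
  · have h1 := fl_var hH w ξ t
    rw [fderiv_ell hH.1] at h1
    have h2 := fl_der hH w t
    have h3 := (hd_snd h1).sub (hasDerivAt_dot (hd_fst (hd_fst h2)) (hd_snd (hd_fst h1)))
    refine h3.congr_deriv ?_
    simp only [ell]
    rw [fderiv_eq_dot, neg_dotProduct, dotProduct_comm (dQ H _)]
    ring

theorem fl_Om {n : ℕ} {H : Phase n → ℝ} (hH : SmoothCpt H) (t : ℝ) (w ξ η : CV n) :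
    Om (fderiv ℝ (fl H t) w ξ).1 (fderiv ℝ (fl H t) w η).1 = Om ξ.1 η.1 := by
  have := const_of_der (f := fun t => Om (fderiv ℝ (fl H t) w ξ).1 (fderiv ℝ (fl H t) w η).1) (fun t => ?_) t
  · refine this.trans ?_
    rw [ fl_fderiv_zero hH, fl_fderiv_zero hH]
  · have h1 := fl_var hH w ξ t
    have h2 := fl_var hH w η t
    rw [fderiv_ell hH.1] at h1 h2
    have h3 := (hasDerivAt_dot (hd_snd (hd_fst h1)) (hd_fst (hd_fst h2))).sub (hasDerivAt_dot (hd_fst (hd_fst h1)) (hd_snd (hd_fst h2)))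
    refine h3.congr_deriv ?_
    have := fderiv2_symm hH.1 (fl H t w).1 (fderiv ℝ (fl H t) w ξ).1 (fderiv ℝ (fl H t) w η).1
    simp only [neg_dotProduct, dotProduct_neg]
    rw [dotProduct_comm (fderiv ℝ (dP H) _ _), dotProduct_comm (fderiv ℝ (dQ H) _ _)]
    linarith

theorem fl_H {n : ℕ} {H : Phase n → ℝ} (hH : SmoothCpt H) (t : ℝ) (w : CV n) : H (fl H t w).1 = H w.1 := by
  have := const_of_der (f := fun t => H (fl H t w).1) (fun t => ?_) t
  · refine this.trans ?_
    rw [ fl_zero hH]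
  · have h1 := hd_fst (fl_der hH w t)
    have h2 := ((hH.1.differentiable (by norm_num)) (fl H t w).1).hasFDerivAt.comp_hasDerivAt t h1
    refine h2.congr_deriv ?_
    rw [poisson_eq]
    have := poisson_anti H H (fl H t w).1
    linarith

theorem SmoothCpt.neg {n : ℕ} {H : Phase n → ℝ} (hH : SmoothCpt H) : SmoothCpt (fun x => - H x) := by
  refine ⟨hH.1.neg, ?_⟩
  exact HasCompactSupport.comp_left (g := fun y : ℝ => -y) hH.2 (by simp)

theorem fl_neg {n : ℕ} {H : Phase n → ℝ} (hH : SmoothCpt H) (t : ℝ) (w : CV n) :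
    fl (fun x => - H x) t w = fl H (-t) w := by
  refine (fl_unique hH.neg (γ := fun s => fl H (-s) w) (fun s => ?_) (by simp [fl_zero hH]) t).symm
  have h := (fl_der hH w (-s)).scomp s (hasDerivAt_neg s)
  refine h.congr_deriv ?_
  have e : (fun x => - H x) = fun x => (0:ℝ) - H x := by ext x; simp
  have h0 : ell (fun _ : Phase n => (0:ℝ)) (fl H (-s) w).1 = 0 := by
    symm
    refine ell_char (fun η => ?_) ?_
    · simp [Om]
    · simp [alp]
  rw [e, ell_sub (differentiableAt_const _) ((hH.1.differentiable (by norm_num)) _), h0]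
  simp

/-- contact transformations -/
structure IsCT {n : ℕ} (g : Equiv.Perm (CV n)) : Prop where
  c1 : ContDiff ℝ 1 g
  c1' : ContDiff ℝ 1 g.symm
  eqv : ∀ w z, g (w + (0, z)) = g w + (0, z)
  al : ∀ w ξ, alp (g w) (fderiv ℝ g w ξ) = alp w ξ
  om : ∀ w ξ η, Om (fderiv ℝ g w ξ).1 (fderiv ℝ g w η).1 = Om ξ.1 η.1
  lip : ∃ K : ℝ, 0 ≤ K ∧ ∀ v w, ‖g v - g w‖ ≤ K * ‖v - w‖
  lip' : ∃ K : ℝ, 0 ≤ K ∧ ∀ v w, ‖g.symm v - g.symm w‖ ≤ K * ‖v - w‖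

noncomputable def flE {n : ℕ} {H : Phase n → ℝ} (hH : SmoothCpt H) (t : ℝ) : Equiv.Perm (CV n) where
  toFun := fl H t
  invFun := fl H (-t)
  left_inv w := by rw [← fl_add hH]; simp [fl_zero hH]
  right_inv w := by rw [← fl_add hH]; simp [fl_zero hH]

theorem flE_apply {n : ℕ} {H : Phase n → ℝ} (hH : SmoothCpt H) (t : ℝ) (w : CV n) : flE hH t w = fl H t w := rfl
theorem flE_symm {n : ℕ} {H : Phase n → ℝ} (hH : SmoothCpt H) (t : ℝ) (w : CV n) :
    (flE hH t).symm w = fl H (-t) w := rfl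

theorem flE_isCT {n : ℕ} {H : Phase n → ℝ} (hH : SmoothCpt H) (t : ℝ) : IsCT (flE hH t) where
  c1 := fl_contDiff' hH t
  c1' := fl_contDiff' hH (-t)
  eqv := fl_eqv hH t
  al := fl_alp hH t
  om := fl_Om hH t
  lip := by
    obtain ⟨K, h0, h⟩ := fl_lip hH
    exact ⟨_, (Real.exp_pos _).le, h t⟩
  lip' := by
    obtain ⟨K, h0, h⟩ := fl_lip hH
    exact ⟨_, (Real.exp_pos _).le, h (-t)⟩

theorem IsCT.one {n : ℕ} : IsCT (1 : Equiv.Perm (CV n)) where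
  c1 := contDiff_id
  c1' := contDiff_id
  eqv _ _ := rfl
  al w ξ := by
    have : fderiv ℝ (⇑(1 : Equiv.Perm (CV n))) w = ContinuousLinearMap.id ℝ _ := fderiv_id
    rw [this]; rfl
  om w ξ η := by
    have : fderiv ℝ (⇑(1 : Equiv.Perm (CV n))) w = ContinuousLinearMap.id ℝ _ := fderiv_id
    rw [this]; rfl
  lip := ⟨1, by norm_num, fun v w => by simp⟩
  lip' := ⟨1, by norm_num, fun v w => by rw [one_mul]; rfl⟩

theorem IsCT.mul {n : ℕ} {g k : Equiv.Perm (CV n)} (hg : IsCT g) (hk : IsCT k) : IsCT (g * k) := by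
  have hd : ∀ w, fderiv ℝ (⇑(g * k)) w = (fderiv ℝ g (k w)).comp (fderiv ℝ k w) := fun w =>
    fderiv_comp w (hg.c1.differentiable (by norm_num) _) (hk.c1.differentiable (by norm_num) _)
  refine ⟨hg.c1.comp hk.c1, hk.c1'.comp hg.c1', fun w z => ?_, fun w ξ => ?_, fun w ξ η => ?_, ?_, ?_⟩
  · rw [Equiv.Perm.mul_apply, Equiv.Perm.mul_apply, hk.eqv, hg.eqv]
  · rw [hd, Equiv.Perm.mul_apply, ContinuousLinearMap.comp_apply, hg.al, hk.al]
  · rw [hd, ContinuousLinearMap.comp_apply, ContinuousLinearMap.comp_apply, hg.om, hk.om]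
  · obtain ⟨a, a0, ha⟩ := hg.lip
    obtain ⟨b, b0, hb⟩ := hk.lip
    exact ⟨a * b, by positivity, fun v w => (ha _ _).trans (by rw [mul_assoc]; gcongr; exact hb _ _)⟩
  · obtain ⟨a, a0, ha⟩ := hg.lip'
    obtain ⟨b, b0, hb⟩ := hk.lip'
    exact ⟨b * a, by positivity, fun v w => (hb _ _).trans (by rw [mul_assoc]; gcongr; exact ha _ _)⟩

/-- push-forward of functions on phase space -/
def pull {n : ℕ} (g : Equiv.Perm (CV n)) (H : Phase n → ℝ) (x : Phase n) : ℝ := H (g.symm (x, 0)).1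

theorem IsCT.eqv' {n : ℕ} {g : Equiv.Perm (CV n)} (hg : IsCT g) (w : CV n) (z : ℝ) :
    g.symm (w + (0, z)) = g.symm w + (0, z) := by
  rw [Equiv.symm_apply_eq, hg.eqv, Equiv.apply_symm_apply]

theorem IsCT.symm_fst {n : ℕ} {g : Equiv.Perm (CV n)} (hg : IsCT g) (w : CV n) :
    (g.symm (w.1, 0)).1 = (g.symm w).1 := by
  have := hg.eqv' (w.1, 0) w.2
  have e : ((w.1, 0) : CV n) + (0, w.2) = w := by ext <;> simp
  rw [e] at this
  rw [this]; simp

theorem IsCT.pull_apply {n : ℕ} {g : Equiv.Perm (CV n)} (hg : IsCT g) (H : Phase n → ℝ) (w : CV n) :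
    pull g H w.1 = H (g.symm w).1 := by rw [pull, hg.symm_fst]

theorem IsCT.pull_apply' {n : ℕ} {g : Equiv.Perm (CV n)} (hg : IsCT g) (H : Phase n → ℝ) (w : CV n) :
    pull g H (g w).1 = H w.1 := by rw [hg.pull_apply, Equiv.symm_apply_apply]

theorem IsCT.pull_mul {n : ℕ} {g k : Equiv.Perm (CV n)} (hk : IsCT k) (H : Phase n → ℝ) :
    pull (g * k) H = pull g (pull k H) := by
  ext x
  show H (k.symm (g.symm (x, 0))).1 = pull k H (g.symm (x, 0)).1
  rw [hk.pull_apply]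

theorem IsCT.pull_c1 {n : ℕ} {g : Equiv.Perm (CV n)} (hg : IsCT g) {H : Phase n → ℝ} (hH : ContDiff ℝ 1 H) :
    ContDiff ℝ 1 (pull g H) :=
  hH.comp (contDiff_fst.comp (hg.c1'.comp (contDiff_id.prodMk contDiff_const)))

theorem IsCT.pull_cpt {n : ℕ} {g : Equiv.Perm (CV n)} (hg : IsCT g) {H : Phase n → ℝ} (hH : HasCompactSupport H) :
    HasCompactSupport (pull g H) := by
  have hc : Continuous (fun x : Phase n => (g (x, 0)).1) := by
    have := hg.c1.continuous
    fun_prop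
  refine HasCompactSupport.intro (hH.isCompact.image hc) fun x hx => ?_
  by_contra h
  refine hx ⟨(g.symm (x, 0)).1, subset_tsupport _ h, ?_⟩
  have := hg.eqv ((g.symm (x, 0)).1, 0) (g.symm (x, 0)).2
  have e : (((g.symm (x, 0)).1, 0) : CV n) + (0, (g.symm (x, 0)).2) = g.symm (x, 0) := by ext <;> simp
  rw [e, Equiv.apply_symm_apply] at this
  have := congrArg Prod.fst this
  simpa using this.symm

theorem IsCT.conj {n : ℕ} {g : Equiv.Perm (CV n)} (hg : IsCT g) {H : Phase n → ℝ} (hH : ContDiff ℝ 1 H) (w : CV n) :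
    fderiv ℝ g w (ell H w.1) = ell (pull g H) (g w).1 := by
  have hgd : HasFDerivAt g (fderiv ℝ g w) w := (hg.c1.differentiable (by norm_num) w).hasFDerivAt
  have hinv : ∀ η, fderiv ℝ g w (fderiv ℝ g.symm (g w) η) = η := by
    intro η
    have h1 : HasFDerivAt g.symm (fderiv ℝ g.symm (g w)) (g w) :=
      (hg.c1'.differentiable (by norm_num) _).hasFDerivAt
    have h2 : HasFDerivAt g (fderiv ℝ g w) (g.symm (g w)) := by rwa [Equiv.symm_apply_apply]
    have h3 := h2.comp (g w) h1
    have h4 : (⇑g ∘ ⇑g.symm) = id := by ext1 x; simp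
    rw [h4] at h3
    have := congrArg (fun A => A η) (h3.unique (hasFDerivAt_id _))
    simpa using this
  have hder : ∀ ξ, fderiv ℝ (pull g H) (g w).1 (fderiv ℝ g w ξ).1 = fderiv ℝ H w.1 ξ.1 := by
    intro ξ
    have h1 : HasFDerivAt (pull g H) (fderiv ℝ (pull g H) (g w).1) (g w).1 :=
      ((hg.pull_c1 hH).differentiable (by norm_num) _).hasFDerivAt
    have h2 := h1.comp w hgd.fst
    have h3 : HasFDerivAt (fun w : CV n => H w.1) _ w :=
      ((hH.differentiable (by norm_num) w.1).hasFDerivAt).comp w hasFDerivAt_fst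
    have e : (pull g H ∘ fun x => (g x).1) = fun w : CV n => H w.1 := by
      ext1 x; exact hg.pull_apply' H x
    rw [e] at h2
    have := congrArg (fun A => A ξ) (h2.unique h3)
    simpa using this
  refine ell_char (fun η => ?_) ?_
  · have e : η = (fderiv ℝ g w (fderiv ℝ g.symm (g w) (η, 0))).1 := by rw [hinv]
    rw [e, hg.om, hder, Om_ell]
  · rw [hg.al, alp_ell, hg.pull_apply']

theorem pull_fl_self {n : ℕ} {H : Phase n → ℝ} (hH : SmoothCpt H) (t : ℝ) : pull (flE hH t) H = H := by
  ext x
  rw [pull, flE_symm, fl_H hH]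

/-- a `C¹` path of contact transformations generated by the functions `K v` -/
structure GenPath {n : ℕ} (σ : ℝ) (K : ℝ → Phase n → ℝ) (P R : ℝ → CV n → CV n) : Prop where
  kc : ∀ v, ContDiff ℝ 1 (K v)
  ks : ∀ v, HasCompactSupport (K v)
  bd : ∃ B : ℝ, 0 ≤ B ∧ ∀ v, |v| ≤ σ → ∀ x, |K v x| ≤ B ∧ ‖fderiv ℝ (K v) x‖ ≤ B
  pc : ContDiff ℝ 1 (fun p : ℝ × CV n => P p.1 p.2)
  rc : ContDiff ℝ 1 (fun p : ℝ × CV n => R p.1 p.2)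
  rp : ∀ v y, R v (P v y) = y
  pr : ∀ v y, P v (R v y) = y
  der : ∀ v y, HasDerivAt (fun s => P s y) (ell (K v) (P v y).1) v

theorem joint_der {W V : Type*} [NormedAddCommGroup W] [NormedSpace ℝ W] [NormedAddCommGroup V] [NormedSpace ℝ V]
    {Φ : ℝ → V → W} (hc : ContDiff ℝ 1 (fun p : ℝ × V => Φ p.1 p.2)) {u : ℝ → V} {u' : V} {v : ℝ} {a : W}
    (ha : HasDerivAt (fun s => Φ s (u v)) a v) (hu : HasDerivAt u u' v) :
    HasDerivAt (fun s => Φ s (u s)) (a + fderiv ℝ (Φ v) (u v) u') v := by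
  have hF : HasFDerivAt (fun p : ℝ × V => Φ p.1 p.2) (fderiv ℝ (fun p : ℝ × V => Φ p.1 p.2) (v, u v)) (v, u v) :=
    (hc.differentiable (by norm_num) _).hasFDerivAt
  set A := fderiv ℝ (fun p : ℝ × V => Φ p.1 p.2) (v, u v)
  have h1 : HasDerivAt (fun s => Φ s (u s)) (A (1, u')) v :=
    HasFDerivAt.comp_hasDerivAt (f := fun s => (s, u s)) v hF ((hasDerivAt_id' v).prodMk hu)
  have h2 : HasDerivAt (fun s => Φ s (u v)) (A (1, 0)) v :=
    HasFDerivAt.comp_hasDerivAt (f := fun s => (s, u v)) v hF ((hasDerivAt_id' v).prodMk (hasDerivAt_const v (u v)))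
  have h3 : HasFDerivAt (Φ v) (A.comp (ContinuousLinearMap.inr ℝ ℝ V)) (u v) :=
    hF.comp (u v) (hasFDerivAt_prodMk_right v (u v))
  have e : A (1, u') = A (1, 0) + A (0, u') := by rw [← map_add]; simp
  rw [h3.fderiv, ha.unique h2]
  refine h1.congr_deriv ?_
  rw [e]; simp

theorem piece_gen {n : ℕ} {H H' : Phase n → ℝ} (hH : SmoothCpt H) (hH' : SmoothCpt H') {C B D : Equiv.Perm (CV n)}
    (hC : IsCT C) (hB : IsCT B) (hD : IsCT D) (σ : ℝ) :
    GenPath σ (fun v => pull (C * flE hH v) (fun x => H x - pull B H' x))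
      (fun v y => C (fl H v (B (fl H' (-v) (D y)))))
      (fun v w => D.symm (fl H' v (B.symm (fl H (-v) (C.symm w))))) := by
  have c1 : ContDiff ℝ 1 H := hH.1.of_le (by norm_cast)
  have c1' : ContDiff ℝ 1 H' := hH'.1.of_le (by norm_cast)
  have cB := hB.pull_c1 c1'
  have hMc : ContDiff ℝ 1 (fun x => H x - pull B H' x) := c1.sub cB
  have hMs : HasCompactSupport (fun x => H x - pull B H' x) := hH.2.sub (hB.pull_cpt hH'.2)
  refine ⟨fun v => (hC.mul (flE_isCT hH v)).pull_c1 hMc, fun v => (hC.mul (flE_isCT hH v)).pull_cpt hMs, ?_, ?_, ?_, ?_,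
    ?_, ?_⟩
  · obtain ⟨b, hb⟩ := hMs.exists_bound_of_continuous hMc.continuous
    obtain ⟨m, m0, hm⟩ := lipc hMs hMc
    obtain ⟨c, cc0, hc⟩ := hC.lip'
    obtain ⟨κ, κ0, hκ⟩ := fl_lip hH
    have hb0 : 0 ≤ b := (norm_nonneg _).trans (hb 0)
    refine ⟨max b (m * (Real.exp (κ * σ) * c)), le_max_of_le_left hb0, fun v hv x => ⟨?_, ?_⟩⟩
    · exact le_max_of_le_left (hb _)
    · refine le_max_of_le_right ?_
      refine (((hC.mul (flE_isCT hH v)).pull_c1 hMc).differentiable (by norm_num) x).hasFDerivAt.le_of_lip'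
        (by positivity) (Filter.Eventually.of_forall fun y => ?_)
      refine (hm _ _).trans ?_
      rw [mul_assoc]
      gcongr
      change ‖(fl H (-v) (C.symm (y, 0))).1 - (fl H (-v) (C.symm (x, 0))).1‖ ≤ _
      refine (norm_fst_le (fl H (-v) (C.symm (y, 0)) - fl H (-v) (C.symm (x, 0)))).trans ?_
      refine (hκ _ _ _).trans ?_
      rw [mul_assoc, abs_neg]
      have h1 := hc (y, 0) (x, 0)
      have h2 : ‖((y, 0) : CV n) - (x, 0)‖ = ‖y - x‖ := by
        rw [Prod.mk_sub_mk, Prod.norm_mk, sub_self, norm_zero]; simp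
      rw [h2] at h1
      gcongr
  · have h1 := fl_contDiff hH
    have h2 := fl_contDiff hH'
    have h3 : ContDiff ℝ 1 (fun p : ℝ × CV n => fl H' (-p.1) (D p.2)) :=
      h2.comp (contDiff_fst.neg.prodMk (hD.c1.comp contDiff_snd))
    have h4 : ContDiff ℝ 1 (fun p : ℝ × CV n => fl H p.1 (B (fl H' (-p.1) (D p.2)))) :=
      h1.comp (contDiff_fst.prodMk (hB.c1.comp h3))
    exact hC.c1.comp h4
  · have h1 := fl_contDiff hH
    have h2 := fl_contDiff hH'
    have h3 : ContDiff ℝ 1 (fun p : ℝ × CV n => fl H (-p.1) (C.symm p.2)) :=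
      h1.comp (contDiff_fst.neg.prodMk (hC.c1'.comp contDiff_snd))
    have h4 : ContDiff ℝ 1 (fun p : ℝ × CV n => fl H' p.1 (B.symm (fl H (-p.1) (C.symm p.2)))) :=
      h2.comp (contDiff_fst.prodMk (hB.c1'.comp h3))
    exact hD.c1'.comp h4
  · intro v y
    simp only [Equiv.symm_apply_apply, ← fl_add hH, ← fl_add hH', neg_add_cancel, add_neg_cancel, fl_zero hH, fl_zero hH']
  · intro v y
    simp only [Equiv.apply_symm_apply, ← fl_add hH, ← fl_add hH', neg_add_cancel, add_neg_cancel, fl_zero hH, fl_zero hH']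
  · intro v y
    have h1 : HasDerivAt (fun s => fl H' (-s) (D y)) (-ell H' (fl H' (-v) (D y)).1) v := by
      have := (fl_der hH' (D y) (-v)).scomp v (hasDerivAt_neg v)
      refine this.congr_deriv (by simp)
    have h2 : HasDerivAt (fun s => B (fl H' (-s) (D y))) (-ell (pull B H') (B (fl H' (-v) (D y))).1) v := by
      have := (hB.c1.differentiable (by norm_num) (fl H' (-v) (D y))).hasFDerivAt.comp_hasDerivAt v h1
      refine this.congr_deriv ?_
      rw [map_neg, hB.conj c1']
    have h3 := joint_der (fl_contDiff hH) (fl_der hH _ v) h2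
    have e3 : ell H (fl H v (B (fl H' (-v) (D y)))).1 +
        fderiv ℝ (fl H v) (B (fl H' (-v) (D y))) (-ell (pull B H') (B (fl H' (-v) (D y))).1) =
        ell (pull (flE hH v) (fun x => H x - pull B H' x)) (fl H v (B (fl H' (-v) (D y)))).1 := by
      have a := (flE_isCT hH v).conj cB (B (fl H' (-v) (D y)))
      have b := (flE_isCT hH v).conj hMc (B (fl H' (-v) (D y)))
      have d := (flE_isCT hH v).conj c1 (B (fl H' (-v) (D y)))
      rw [pull_fl_self] at d
      rw [flE_apply] at a b d
      rw [← b, ← d, ell_sub (c1.differentiable (by norm_num) _) (cB.differentiable (by norm_num) _), map_sub, map_neg]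
      exact (sub_eq_add_neg _ _).symm
    rw [e3] at h3
    have h4 := (hC.c1.differentiable (by norm_num) (fl H v (B (fl H' (-v) (D y))))).hasFDerivAt.comp_hasDerivAt v h3
    refine h4.congr_deriv ?_
    rw [hC.conj ((flE_isCT hH v).pull_c1 hMc), (flE_isCT hH v).pull_mul]

/-- uniform differentiability on compact sets -/
theorem unif_diff {E W : Type*} [NormedAddCommGroup E] [NormedSpace ℝ E] [NormedAddCommGroup W] [NormedSpace ℝ W]
    {f : E → W} (hf : ContDiff ℝ 1 f) {S : Set E} (hS : IsCompact S) {ε : ℝ} (hε : 0 < ε) :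
    ∃ δ > 0, ∀ a ∈ S, ∀ b, ‖b - a‖ < δ → ‖f b - f a - fderiv ℝ f a (b - a)‖ ≤ ε * ‖b - a‖ := by
  have hc := hf.continuous_fderiv (by norm_num)
  have h := hS.uniformContinuousAt_of_continuousAt (fderiv ℝ f) (fun a _ => hc.continuousAt)
    (Metric.dist_mem_uniformity hε)
  obtain ⟨δ, hδ, h⟩ := Metric.mem_uniformity_dist.1 h
  refine ⟨δ, hδ, fun a ha b hb => ?_⟩
  have := Convex.norm_image_sub_le_of_norm_hasFDerivWithin_le' (f := f) (f' := fderiv ℝ f) (φ := fderiv ℝ f a)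
    (s := Metric.ball a δ) (C := ε) (x := a) (y := b)
    (fun x _ => ((hf.differentiable (by norm_num)) x).hasFDerivAt.hasFDerivWithinAt) (fun x hx => ?_)
    (convex_ball _ _) (by simpa using hδ) (by simpa [dist_eq_norm] using hb)
  · exact this
  · have := h (a := a) (b := x) (by rw [dist_comm]; exact hx) ha
    simp only [Set.mem_setOf_eq, dist_eq_norm] at this
    rw [norm_sub_rev]; exact this.le

theorem GenPath.ell_eq {n : ℕ} {σ : ℝ} {K : ℝ → Phase n → ℝ} {P R : ℝ → CV n → CV n} (g : GenPath σ K P R)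
    (v : ℝ) (x : Phase n) : ell (K v) x = fderiv ℝ (fun p : ℝ × CV n => P p.1 p.2) (v, R v (x, 0)) (1, 0) := by
  have hF : HasFDerivAt (fun p : ℝ × CV n => P p.1 p.2) _ (v, R v (x, 0)) :=
    (g.pc.differentiable (by norm_num) _).hasFDerivAt
  have h2 := HasFDerivAt.comp_hasDerivAt (f := fun s => (s, R v (x, 0))) v hF
    ((hasDerivAt_id' v).prodMk (hasDerivAt_const v (R v (x, 0))))
  have h3 := g.der v (R v (x, 0))
  rw [g.pr] at h3
  exact h3.unique h2

theorem GenPath.ell_cont {n : ℕ} {σ : ℝ} {K : ℝ → Phase n → ℝ} {P R : ℝ → CV n → CV n} (g : GenPath σ K P R) :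
    Continuous (fun a : ℝ × Phase n => ell (K a.1) a.2) := by
  have h1 := g.pc.continuous_fderiv (by norm_num)
  have h2 := g.rc.continuous
  have h3 : Continuous (fun a : ℝ × Phase n => R a.1 (a.2, 0)) :=
    h2.comp (g := fun p : ℝ × CV n => R p.1 p.2) (f := fun a : ℝ × Phase n => (a.1, ((a.2, 0) : CV n))) (by fun_prop)
  have h4 : Continuous (fun a : ℝ × Phase n => fderiv ℝ (fun p : ℝ × CV n => P p.1 p.2) (a.1, R a.1 (a.2, 0)) (1, 0)) :=
    (h1.comp (continuous_fst.prodMk h3)).clm_apply continuous_const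
  simpa only [← g.ell_eq] using h4

theorem GenPath.r_zero {n : ℕ} {σ : ℝ} {K : ℝ → Phase n → ℝ} {P R : ℝ → CV n → CV n} (g : GenPath σ K P R)
    (v : ℝ) (w : CV n) : fderiv ℝ (fun p : ℝ × CV n => R p.1 p.2) (v, w) (1, ell (K v) w.1) = 0 := by
  have h1 := g.der v (R v w)
  rw [g.pr] at h1
  have hF : HasFDerivAt (fun p : ℝ × CV n => R p.1 p.2) (fderiv ℝ (fun p : ℝ × CV n => R p.1 p.2) (v, w))
      (v, P v (R v w)) := by
    rw [g.pr]; exact (g.rc.differentiable (by norm_num) _).hasFDerivAt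
  have h2 := HasFDerivAt.comp_hasDerivAt (f := fun s => (s, P s (R v w))) v hF
    ((hasDerivAt_id' v).prodMk h1)
  have e : ((fun p : ℝ × CV n => R p.1 p.2) ∘ fun s => (s, P s (R v w))) = fun _ => R v w := by
    ext1 s; exact g.rp s (R v w)
  rw [e] at h2
  exact h2.unique (hasDerivAt_const v _)

set_option maxHeartbeats 1600000 in
theorem GenPath.step {n : ℕ} {σ : ℝ} {K : ℝ → Phase n → ℝ} {P R : ℝ → CV n → CV n} (g : GenPath σ K P R)
    {ρ ε : ℝ} (hρ : 0 ≤ ρ) (hε : 0 < ε) :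
    ∃ h0 > 0, ∀ h, 0 < h → h ≤ h0 → ∀ v, 0 ≤ v → v ≤ σ → ∀ (p q p' q' : Fin n → ℝ) (z z' : ℝ),
      ‖((p, q), z)‖ ≤ ρ → ‖p'‖ ≤ ρ → ‖q' - q - h • dP (K v) (p', q)‖ ≤ h ^ 2 →
      ‖p' - p + h • dQ (K v) (p', q)‖ ≤ h ^ 2 → z' - z = p' ⬝ᵥ (q' - q) - h * K v (p', q) →
      ‖R (v + h) ((p', q'), z') - R v ((p, q), z)‖ ≤ ε * h := by
  obtain ⟨B, hB0, hB⟩ := g.bd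
  have hS : IsCompact (Set.Icc (0:ℝ) σ ×ˢ Metric.closedBall (0 : Phase n) ρ) :=
    isCompact_Icc.prod (isCompact_closedBall _ _)
  have hS' : IsCompact (Set.Icc (0:ℝ) σ ×ˢ Metric.closedBall (0 : CV n) ρ) :=
    isCompact_Icc.prod (isCompact_closedBall _ _)
  obtain ⟨B', hB'⟩ := hS.exists_bound_of_continuousOn g.ell_cont.continuousOn
  obtain ⟨D, hD⟩ := hS'.exists_bound_of_continuousOn (g.rc.continuous_fderiv (by norm_num)).continuousOn
  set A := |B'| + n * ρ + 3 with hA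
  have hA1 : 1 ≤ A := by have := abs_nonneg B'; have : 0 ≤ (n:ℝ) * ρ := by positivity
                         linarith
  have hDD : 0 < |D| + 1 := by positivity
  have hnρ : 0 ≤ (n:ℝ) * ρ := by positivity
  set ε2 := min 1 (ε / (4 * (|D| + 1))) with hε2
  have hε2p : 0 < ε2 := by positivity
  have huc := hS.uniformContinuousAt_of_continuousAt (fun a : ℝ × Phase n => ell (K a.1) a.2)
    (fun a _ => g.ell_cont.continuousAt) (Metric.dist_mem_uniformity hε2p)
  obtain ⟨δ2, hδ2, huc⟩ := Metric.mem_uniformity_dist.1 huc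
  obtain ⟨δ1, hδ1, hud⟩ := unif_diff g.rc hS' (ε := ε / (2 * A)) (by positivity)
  refine ⟨min (min 1 (ε / (4 * (|D| + 1) * (1 + n * ρ)))) (min (δ1 / (2 * A)) (δ2 / (2 * (B + 1)))),
    by positivity, ?_⟩
  intro h hh hle v hv0 hv1 p q p' q' z z' hw hp' h1 h2 h3
  have hl1 : h ≤ 1 := hle.trans ((min_le_left _ _).trans (min_le_left _ _))
  have hl2 : h ≤ ε / (4 * (|D| + 1) * (1 + n * ρ)) := hle.trans ((min_le_left _ _).trans (min_le_right _ _))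
  have hl3 : h ≤ δ1 / (2 * A) := hle.trans ((min_le_right _ _).trans (min_le_left _ _))
  have hl4 : h ≤ δ2 / (2 * (B + 1)) := hle.trans ((min_le_right _ _).trans (min_le_right _ _))
  rw [le_div_iff₀ (by positivity)] at hl2 hl3 hl4
  have hvσ : |v| ≤ σ := by rw [abs_of_nonneg hv0]; exact hv1
  have hx : ‖((p, q) : Phase n)‖ ≤ ρ := (norm_fst_le (((p, q), z) : CV n)).trans hw
  have hpp : ‖p' - p‖ < δ2 := by
    have e : p' - p = (p' - p + h • dQ (K v) (p', q)) - h • dQ (K v) (p', q) := by abel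
    have : ‖p' - p‖ ≤ h ^ 2 + h * B := by
      rw [e]
      refine (norm_sub_le _ _).trans (add_le_add h2 ?_)
      rw [norm_smul, Real.norm_of_nonneg hh.le]
      gcongr
      exact (norm_dQ_le _ _).trans (hB v hvσ _).2
    nlinarith
  set ℓ := ell (K v) (p, q) with hℓ
  have hℓℓ : ‖ell (K v) (p', q) - ℓ‖ < ε2 := by
    have := huc (a := (v, (p, q))) (b := (v, (p', q))) (by
      simp only [dist_eq_norm, Prod.mk_sub_mk, sub_self, Prod.norm_mk, norm_zero, norm_sub_rev p p']
      simp [hpp, hδ2]) ⟨⟨hv0, hv1⟩, by simpa using hx⟩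
    simp only [Set.mem_setOf_eq] at this
    rw [dist_comm, dist_eq_norm] at this
    exact this
  have hℓb : ‖ℓ‖ ≤ |B'| := (hB' (v, (p, q)) ⟨⟨hv0, hv1⟩, by simpa using hx⟩).trans (le_abs_self _)
  set w : CV n := ((p, q), z) with hwdef
  set w' : CV n := ((p', q'), z') with hwdef'
  have he1 : ‖w' - w - h • ell (K v) (p', q)‖ ≤ (1 + n * ρ) * h ^ 2 := by
    have e : w' - w - h • ell (K v) (p', q) = ((p' - p + h • dQ (K v) (p', q), q' - q - h • dP (K v) (p', q)),
        p' ⬝ᵥ (q' - q - h • dP (K v) (p', q))) := by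
      refine Prod.ext (Prod.ext ?_ ?_) ?_
      · simp [w, w', ell]
      · simp [w, w', ell]
      · simp only [w, w', ell, Prod.snd_sub, Prod.smul_snd, h3, dotProduct_sub, dotProduct_smul, smul_eq_mul]; ring
    rw [e]
    have hle1 : h ^ 2 ≤ (1 + n * ρ) * h ^ 2 := by nlinarith [sq_nonneg h]
    refine max_le (max_le (h2.trans hle1) (h1.trans hle1)) ?_
    refine (abs_dot_le _ _).trans ?_
    calc n * ‖p'‖ * ‖q' - q - h • dP (K v) (p', q)‖ ≤ n * ρ * h ^ 2 := by gcongr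
      _ ≤ _ := by nlinarith [sq_nonneg h]
  set e := w' - w - h • ℓ with hedef
  have he : ‖e‖ ≤ (1 + n * ρ) * h ^ 2 + h * ε2 := by
    have e' : e = (w' - w - h • ell (K v) (p', q)) + h • (ell (K v) (p', q) - ℓ) := by
      rw [hedef, smul_sub]; abel
    rw [e']
    refine (norm_add_le _ _).trans (add_le_add he1 ?_)
    rw [norm_smul, Real.norm_of_nonneg hh.le]
    gcongr
  have hε21 : ε2 ≤ 1 := min_le_left _ _
  have hε22 : ε2 ≤ ε / (4 * (|D| + 1)) := min_le_right _ _
  rw [le_div_iff₀ (by positivity)] at hε22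
  have hww : ‖w' - w‖ ≤ A * h := by
    have e' : w' - w = e + h • ℓ := by rw [hedef]; abel
    rw [e']
    refine (norm_add_le _ _).trans ?_
    rw [norm_smul, Real.norm_of_nonneg hh.le]
    have : (1 + n * ρ) * h ^ 2 ≤ (1 + n * ρ) * h := by
      gcongr; nlinarith
    rw [hA]
    nlinarith
  have hab : ‖((v + h, w') : ℝ × CV n) - (v, w)‖ ≤ A * h := by
    rw [Prod.mk_sub_mk, add_sub_cancel_left]
    refine max_le ?_ hww
    rw [Real.norm_of_nonneg hh.le]
    exact le_mul_of_one_le_left hh.le hA1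
  have hmain := hud (v, w) ⟨⟨hv0, hv1⟩, by simpa using hw⟩ (v + h, w') (by
    have : 0 < A * h := by positivity
    refine hab.trans_lt ?_
    linarith)
  have hDv := (hD (v, w) ⟨⟨hv0, hv1⟩, by simpa using hw⟩).trans (le_abs_self D)
  set DR := fderiv ℝ (fun p : ℝ × CV n => R p.1 p.2) (v, w) with hDR
  have hzero : DR (((v + h, w') : ℝ × CV n) - (v, w)) = DR (0, e) := by
    have e1 : ((v + h, w') : ℝ × CV n) - (v, w) = h • ((1, ℓ) : ℝ × CV n) + (0, e) := by
      rw [Prod.mk_sub_mk, hedef]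
      ext1
      · simp
      · simp
    rw [e1, map_add, map_smul]
    have := g.r_zero v w
    rw [← hDR] at this
    have h0 : DR (1, ℓ) = 0 := this
    rw [h0]; simp
  rw [hzero] at hmain
  have hDe : ‖DR (0, e)‖ ≤ |D| * ‖e‖ := by
    refine (DR.le_opNorm _).trans ?_
    have : ‖((0, e) : ℝ × CV n)‖ = ‖e‖ := by rw [Prod.norm_mk]; simp
    rw [this]
    gcongr
  have hfin : ‖R (v + h) w' - R v w‖ ≤ ε / (2 * A) * (A * h) + |D| * ((1 + n * ρ) * h ^ 2 + h * ε2) := by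
    calc _ = ‖(R (v + h) w' - R v w - DR (0, e)) + DR (0, e)‖ := by rw [sub_add_cancel]
      _ ≤ _ := norm_add_le _ _
      _ ≤ _ := add_le_add (hmain.trans (by gcongr)) (hDe.trans (by gcongr))
  have hAA : ε / (2 * A) * (A * h) = ε * h / 2 := by field_simp
  rw [hAA] at hfin
  have hD0 : 0 ≤ |D| := abs_nonneg _
  have i1 : |D| * ((1 + n * ρ) * h ^ 2) ≤ ε / 4 * h := by
    have : (|D| + 1) * (1 + n * ρ) * h ≤ ε / 4 := by nlinarith
    have h5 : |D| * (1 + n * ρ) * h ≤ ε / 4 := by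
      refine le_trans ?_ this
      gcongr; linarith
    nlinarith
  have i2 : |D| * (h * ε2) ≤ ε / 4 * h := by
    have : |D| * ε2 ≤ ε / 4 := by nlinarith
    nlinarith
  linarith

theorem fin_min {Q : ℕ → ℝ → Prop} (hQ : ∀ k, ∃ h0 > 0, ∀ h, 0 < h → h ≤ h0 → Q k h) (m : ℕ) :
    ∃ h0 > 0, ∀ k < m, ∀ h, 0 < h → h ≤ h0 → Q k h := by
  induction m with
  | zero => exact ⟨1, by norm_num, fun k hk => absurd hk (by omega)⟩
  | succ m ih =>
    obtain ⟨a, ha, iha⟩ := ih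
    obtain ⟨b, hb, ihb⟩ := hQ m
    refine ⟨min a b, lt_min ha hb, fun k hk h h1 h2 => ?_⟩
    rcases Nat.lt_succ_iff_lt_or_eq.1 hk with h3 | h3
    · exact iha k h3 h h1 (h2.trans (min_le_left _ _))
    · subst h3; exact ihb h h1 (h2.trans (min_le_right _ _))

theorem acc_le {E : Type*} [NormedAddCommGroup E] {a : ℕ → E} {c : ℝ} {i j : ℕ} (hij : i ≤ j)
    (h : ∀ k, i ≤ k → k < j → ‖a (k + 1) - a k‖ ≤ c) : ‖a j - a i‖ ≤ ((j:ℝ) - i) * c := by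
  have := dist_le_Ico_sum_of_dist_le (f := a) hij (d := fun _ => c) (fun {k} h1 h2 => by
    rw [dist_comm, dist_eq_norm]; exact h k h1 h2)
  rw [dist_comm, dist_eq_norm] at this
  simpa [Nat.cast_sub hij] using this

theorem sum_div {f : ℕ → ℝ} {N : ℕ} (hN : 0 < N) (m : ℕ) :
    ∑ j ∈ Finset.range (m * N), f (j / N) = N * ∑ k ∈ Finset.range m, f k := by
  induction m with
  | zero => simp
  | succ m ih =>
    rw [Nat.succ_mul, Finset.sum_range_add, ih, Finset.sum_range_succ, mul_add]
    congr 1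
    rw [Finset.sum_congr rfl (g := fun _ => f m)]
    · simp
    · intro x hx
      have hx := Finset.mem_range.1 hx
      congr 1
      rw [mul_comm, Nat.mul_add_div hN, Nat.div_eq_of_lt hx, add_zero]

theorem chain {n m : ℕ} (hm : 0 < m) {σ : ℝ} (hσ : 0 < σ) {K : ℕ → ℝ → Phase n → ℝ} {P R : ℕ → ℝ → CV n → CV n}
    (g : ∀ k, GenPath σ (K k) (P k) (R k)) (hR0 : ∀ w, R 0 0 w = w)
    (hR : ∀ k < m, ∀ w, R k σ w = R (k + 1) 0 w) {κ : ℕ → ℝ}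
    (hκ : ∀ k v x, 0 ≤ v → v ≤ σ → - κ k ≤ K k v x) {ε : ℝ} (hε : 0 < ε) :
    ∃ (p0 p1 q1 : Fin n → ℝ) (z : ℝ), ‖p1‖ ≤ ε ∧ z ≤ σ * ∑ k ∈ Finset.range m, κ k ∧
      ‖R m 0 ((p1, q1), z) - ((p0, 0), 0)‖ ≤ ε := by
  -- uniform bounds
  have hbd : ∃ B : ℝ, 0 ≤ B ∧ ∀ k < m, ∀ v, |v| ≤ σ → ∀ x, |K k v x| ≤ B ∧ ‖fderiv ℝ (K k v) x‖ ≤ B := by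
    choose b hb0 hb using fun k => (g k).bd
    refine ⟨∑ k ∈ Finset.range m, b k, Finset.sum_nonneg fun k _ => hb0 k, fun k hk v hv x => ?_⟩
    have h1 : b k ≤ ∑ k ∈ Finset.range m, b k :=
      Finset.single_le_sum (fun k _ => hb0 k) (Finset.mem_range.2 hk)
    exact ⟨(hb k v hv x).1.trans h1, (hb k v hv x).2.trans h1⟩
  obtain ⟨B, hB0, hB⟩ := hbd
  set T := m * σ with hT
  have hT0 : 0 < T := by positivity
  set ρ1 := 1 + T * (B + 1) with hρ1
  have hρ10 : 0 ≤ ρ1 := by positivity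
  set ρ2 := T * (n * ρ1 * (B + 1) + B) with hρ2
  have hρ20 : 0 ≤ ρ2 := by positivity
  set ρ := ρ1 + ρ2 with hρ
  obtain ⟨h0, hh0, hstep⟩ := fin_min (fun k => (g k).step (ρ := ρ) (ε := ε / T) (by positivity) (by positivity)) m
  obtain ⟨N, hN⟩ := exists_nat_gt (σ / min h0 (min 1 ε))
  have hmin : 0 < min h0 (min 1 ε) := by positivity
  have hNpos : 0 < (N:ℝ) := lt_trans (by positivity) hN
  have hN0 : 0 < N := by exact_mod_cast hNpos
  set h := σ / N with hh
  have hpos : 0 < h := by positivity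
  have hle : h ≤ min h0 (min 1 ε) := by
    rw [hh, div_le_iff₀ hNpos]
    rw [div_lt_iff₀ hmin] at hN
    linarith
  have hle0 : h ≤ h0 := hle.trans (min_le_left _ _)
  have hle1 : h ≤ 1 := hle.trans ((min_le_right _ _).trans (min_le_left _ _))
  have hleε : h ≤ ε := hle.trans ((min_le_right _ _).trans (min_le_right _ _))
  have hNh : N * h = σ := by rw [hh]; field_simp
  have hsq : h ^ 2 ≤ h := by nlinarith
  let v : ℕ → ℝ := fun j => (j % N : ℕ) * h
  have hv0 : ∀ j, 0 ≤ v j := fun j => by positivity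
  have hv1 : ∀ j, v j ≤ σ := fun j => by
    rw [← hNh]
    have : ((j % N : ℕ) : ℝ) ≤ N := by exact_mod_cast (Nat.mod_lt j hN0).le
    simp only [v]; gcongr
  obtain ⟨Pj, qj, hq0, hPN, hq, hP, hz⟩ := disc_orbit (m * N) (by positivity) h hpos.le
    (fun j => K (j / N) (v j)) (fun j => (g _).kc _) (fun j => (g _).ks _) (fun j => κ (j / N))
    (fun j x => hκ _ _ _ (hv0 j) (hv1 j)) (h ^ 2) (by positivity)
  have hk : ∀ j, j < m * N → j / N < m := fun j hj => (Nat.div_lt_iff_lt_mul hN0).2 hj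
  have hbK : ∀ j, j < m * N → ∀ x, |K (j / N) (v j) x| ≤ B ∧ ‖fderiv ℝ (K (j / N) (v j)) x‖ ≤ B := fun j hj x =>
    hB _ (hk j hj) _ (by rw [abs_of_nonneg (hv0 j)]; exact hv1 j) x
  have hdq : ∀ j, j < m * N → ‖qj (j + 1) - qj j‖ ≤ h * (B + 1) := by
    intro j hj
    have e : qj (j + 1) - qj j = (qj (j + 1) - qj j - h • dP (K (j / N) (v j)) (Pj (j + 1), qj j)) +
      h • dP (K (j / N) (v j)) (Pj (j + 1), qj j) := by abel
    rw [e]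
    refine (norm_add_le _ _).trans ((add_le_add (hq j hj) (?_ : _ ≤ h * B)).trans (by linarith))
    rw [norm_smul, Real.norm_of_nonneg hpos.le]
    gcongr
    exact (norm_dP_le _ _).trans (hbK j hj _).2
  have hdP : ∀ j, j < m * N → ‖Pj (j + 1) - Pj j‖ ≤ h * (B + 1) := by
    intro j hj
    have e : Pj (j + 1) - Pj j = (Pj (j + 1) - Pj j + h • dQ (K (j / N) (v j)) (Pj (j + 1), qj j)) -
      h • dQ (K (j / N) (v j)) (Pj (j + 1), qj j) := by abel
    rw [e]
    refine (norm_sub_le _ _).trans ((add_le_add (hP j hj) (?_ : _ ≤ h * B)).trans (by linarith))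
    rw [norm_smul, Real.norm_of_nonneg hpos.le]
    gcongr
    exact (norm_dQ_le _ _).trans (hbK j hj _).2
  have hmNh : ((m * N : ℕ) : ℝ) * h = T := by push_cast; rw [mul_assoc, hNh]
  have hjT : ∀ i j : ℕ, i ≤ j → j ≤ m * N → ((j:ℝ) - i) * h ≤ T := by
    intro i j hij hj
    rw [← hmNh]
    have : (j:ℝ) ≤ (m * N : ℕ) := by exact_mod_cast hj
    have : (0:ℝ) ≤ i := by positivity
    gcongr; linarith
  have hqb : ∀ j, j ≤ m * N → ‖qj j‖ ≤ ρ1 := by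
    intro j hj
    have := acc_le (a := qj) (Nat.zero_le j) (fun k _ h2 => hdq k (by omega))
    rw [hq0, sub_zero, ← mul_assoc] at this
    have h3 := mul_le_mul_of_nonneg_right (hjT 0 j (Nat.zero_le _) hj) (by linarith : 0 ≤ B + 1)
    linarith
  have hPb : ∀ j, j ≤ m * N → ‖Pj j‖ ≤ ρ1 := by
    intro j hj
    have := acc_le (a := Pj) hj (fun k _ h2 => hdP k h2)
    rw [← mul_assoc] at this
    have h3 := mul_le_mul_of_nonneg_right (hjT j _ hj le_rfl) (by linarith : 0 ≤ B + 1)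
    have h4 : ‖Pj j‖ ≤ ‖Pj (m * N)‖ + ‖Pj (m * N) - Pj j‖ := by
      have := norm_sub_le (Pj (m * N)) (Pj (m * N) - Pj j)
      rwa [sub_sub_cancel] at this
    linarith
  let z : ℕ → ℝ := fun j => ∑ i ∈ Finset.range j, (Pj (i + 1) ⬝ᵥ (qj (i + 1) - qj i) - h * K (i / N) (v i) (Pj (i + 1), qj i))
  have hz1 : ∀ j, z (j + 1) - z j = Pj (j + 1) ⬝ᵥ (qj (j + 1) - qj j) - h * K (j / N) (v j) (Pj (j + 1), qj j) := by
    intro j; simp only [z, Finset.sum_range_succ]; ring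
  have hdz : ∀ j, j < m * N → ‖z (j + 1) - z j‖ ≤ h * (n * ρ1 * (B + 1) + B) := by
    intro j hj
    rw [hz1]
    refine (norm_sub_le _ _).trans ?_
    have a1 : ‖Pj (j + 1) ⬝ᵥ (qj (j + 1) - qj j)‖ ≤ n * ρ1 * (h * (B + 1)) := by
      refine (abs_dot_le _ _).trans ?_
      gcongr
      · exact hPb _ (by omega)
      · exact hdq j hj
    have a2 : ‖h * K (j / N) (v j) (Pj (j + 1), qj j)‖ ≤ h * B := by
      rw [norm_mul, Real.norm_of_nonneg hpos.le]
      gcongr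
      exact (hbK j hj _).1
    linarith
  have hzb : ∀ j, j ≤ m * N → ‖z j‖ ≤ ρ2 := by
    intro j hj
    have := acc_le (a := z) (Nat.zero_le j) (fun k _ h2 => hdz k (by omega))
    have z0 : z 0 = 0 := by simp [z]
    rw [z0, sub_zero, ← mul_assoc] at this
    have h3 := mul_le_mul_of_nonneg_right (hjT 0 j (Nat.zero_le _) hj)
      (by positivity : 0 ≤ n * ρ1 * (B + 1) + B)
    linarith
  let w : ℕ → CV n := fun j => ((Pj j, qj j), z j)
  have hwb : ∀ j, j ≤ m * N → ‖w j‖ ≤ ρ := by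
    intro j hj
    refine max_le (max_le ?_ ?_) ?_
    · exact (hPb j hj).trans (by linarith)
    · exact (hqb j hj).trans (by linarith)
    · exact (hzb j hj).trans (by linarith)
  let a : ℕ → CV n := fun j => R (j / N) (v j) (w j)
  have hRR : ∀ j, j < m * N → ∀ x, R ((j + 1) / N) (v (j + 1)) x = R (j / N) (v j + h) x := by
    intro j hj x
    have hjd := Nat.div_add_mod j N
    have hlt := Nat.mod_lt j hN0
    by_cases hc : j % N + 1 < N
    · have e1 : (j + 1) / N = j / N := by
        conv_lhs => rw [← hjd, add_assoc, Nat.mul_add_div hN0, Nat.div_eq_of_lt hc, add_zero]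
      have e2 : (j + 1) % N = j % N + 1 := by
        conv_lhs => rw [← hjd, add_assoc, Nat.mul_add_mod, Nat.mod_eq_of_lt hc]
      simp only [v]
      rw [e1, e2]
      push_cast
      rw [add_mul, one_mul]
    · have hc' : j % N + 1 = N := by omega
      have e1 : (j + 1) / N = j / N + 1 := by
        conv_lhs => rw [← hjd, add_assoc, Nat.mul_add_div hN0, hc', Nat.div_self hN0]
      have e2 : (j + 1) % N = 0 := by
        conv_lhs => rw [← hjd, add_assoc, Nat.mul_add_mod, hc', Nat.mod_self]
      have e3 : v j + h = σ := by
        simp only [v]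
        rw [← hNh]
        conv_rhs => rw [← hc']
        push_cast; ring
      rw [e3, e1, hR _ (hk j hj)]
      simp only [v]
      rw [e2]; simp
  have hda : ∀ j, j < m * N → ‖a (j + 1) - a j‖ ≤ ε / T * h := by
    intro j hj
    simp only [a]
    rw [hRR j hj]
    exact hstep _ (hk j hj) h hpos hle0 (v j) (hv0 j) (hv1 j) _ _ _ _ _ _ (hwb j hj.le)
      ((hPb (j + 1) (by omega)).trans (by linarith)) (hq j hj) (hP j hj) (hz1 j)
  have hacc := acc_le (a := a) (Nat.zero_le (m * N)) (fun k _ h2 => hda k h2)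
  refine ⟨Pj 0, Pj (m * N), qj (m * N), z (m * N), ?_, ?_, ?_⟩
  · linarith
  · refine hz.trans (le_of_eq ?_)
    rw [sum_div hN0, ← hNh]; ring
  · have e1 : a (m * N) = R m 0 ((Pj (m * N), qj (m * N)), z (m * N)) := by
      simp only [a, v, w]
      rw [Nat.mul_div_cancel _ hN0, Nat.mul_mod_left]; simp
    have e2 : a 0 = ((Pj 0, 0), 0) := by
      simp only [a, v, w]
      rw [Nat.zero_div, Nat.zero_mod, hq0]
      simp [hR0, z]
    rw [← e1, ← e2]
    refine hacc.trans (le_of_eq ?_)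
    have e4 : ((m * N : ℕ) : ℝ) * h * (ε / T) = ε := by rw [hmNh]; field_simp
    push_cast at e4 ⊢
    linarith

theorem mvt_le {f f' : ℝ → ℝ} {σ C : ℝ} (hσ : 0 ≤ σ) (hf : ∀ t, HasDerivAt f (f' t) t)
    (h : ∀ t, 0 ≤ t → t ≤ σ → f' t ≤ C) : f σ - f 0 ≤ σ * C := by
  have := Convex.image_sub_le_mul_sub_of_deriv_le (D := Set.Icc 0 σ) (convex_Icc _ _) (f := f) (C := C)
    (fun t _ => (hf t).continuousAt.continuousWithinAt) (fun t _ => (hf t).differentiableAt.differentiableWithinAt)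
    (fun t ht => by
      rw [(hf t).deriv]
      have := interior_subset ht
      exact h t this.1 this.2) 0 ⟨le_rfl, hσ⟩ σ ⟨hσ, le_rfl⟩ hσ
  linarith

theorem mvt_norm {E : Type*} [NormedAddCommGroup E] [NormedSpace ℝ E] {f f' : ℝ → E} {σ C a b : ℝ}
    (hf : ∀ t, HasDerivAt f (f' t) t)
    (h : ∀ t, 0 ≤ t → t ≤ σ → ‖f' t‖ ≤ C) (hC : 0 ≤ C) (ha : 0 ≤ a) (ha' : a ≤ σ) (hb : 0 ≤ b) (hb' : b ≤ σ) :
    ‖f b - f a‖ ≤ C * σ := by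
  have := Convex.norm_image_sub_le_of_norm_hasDerivWithin_le (f := f) (s := Set.Icc 0 σ) (C := C)
    (f' := f') (fun s _ => (hf s).hasDerivWithinAt) (fun s hs => h s hs.1 hs.2) (convex_Icc _ _)
    (x := a) (y := b) ⟨ha, ha'⟩ ⟨hb, hb'⟩
  refine this.trans ?_
  gcongr
  rw [Real.norm_eq_abs, abs_le]; constructor <;> linarith

theorem G_der {n : ℕ} {F G : Phase n → ℝ} (hF : SmoothCpt F) (hG : SmoothCpt G) (w : CV n) (t : ℝ) :
    HasDerivAt (fun t => G (fl F t w).1) (- poisson F G (fl F t w).1) t := by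
  have h1 := hd_fst (fl_der hF w t)
  have h2 := ((hG.1.differentiable (by norm_num)) (fl F t w).1).hasFDerivAt.comp_hasDerivAt t h1
  refine h2.congr_deriv ?_
  rw [poisson_eq, poisson_anti]

/-- the difference `G - G ∘ f_σ` -/
noncomputable def Mf {n : ℕ} {F : Phase n → ℝ} (hF : SmoothCpt F) (G : Phase n → ℝ) (σ : ℝ) (x : Phase n) : ℝ :=
  G x - pull (flE hF (-σ)) G x

theorem Mf_eq {n : ℕ} {F : Phase n → ℝ} (hF : SmoothCpt F) (G : Phase n → ℝ) (σ : ℝ) (x : Phase n) :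
    Mf hF G σ x = G (fl F 0 (x, 0)).1 - G (fl F σ (x, 0)).1 := by
  rw [Mf, pull, flE_symm, neg_neg, fl_zero hF]

theorem Mf_le {n : ℕ} {F G : Phase n → ℝ} (hF : SmoothCpt F) (hG : SmoothCpt G) {σ β : ℝ} (hσ : 0 ≤ σ) (x : Phase n)
    (h : ∀ t, 0 ≤ t → t ≤ σ → poisson F G (fl F t (x, 0)).1 ≤ β) : Mf hF G σ x ≤ σ * β := by
  have := mvt_le hσ (fun t => (G_der hF hG (x, 0) t).neg) (C := β) (fun t h1 h2 => by
    simpa using h t h1 h2)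
  rw [Mf_eq]
  simp only [Pi.neg_apply] at this
  linarith

theorem Mf_ge {n : ℕ} {F G : Phase n → ℝ} (hF : SmoothCpt F) (hG : SmoothCpt G) {σ β : ℝ} (hσ : 0 ≤ σ) (x : Phase n)
    (h : ∀ x, β ≤ poisson F G x) : σ * β ≤ Mf hF G σ x := by
  have := mvt_le hσ (fun t => (G_der hF hG (x, 0) t)) (C := -β) (fun t h1 h2 => by
    linarith [h (fl F t (x, 0)).1])
  rw [Mf_eq]
  linarith

theorem poisson_c1 {n : ℕ} {F G : Phase n → ℝ} (hF : SmoothCpt F) (hG : SmoothCpt G) :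
    ContDiff ℝ 1 (poisson F G) := by
  have e : poisson F G = fun x => fderiv ℝ F x (ell G x).1 := funext fun x => (poisson_eq F G x).symm
  rw [e]
  exact (hF.1.fderiv_right (m := 1) (by norm_cast)).clm_apply
    (contDiff_fst.comp ((contDiff_ell hG.1).of_le (by norm_num)))

theorem poisson_cpt {n : ℕ} {F G : Phase n → ℝ} (hF : SmoothCpt F) :
    HasCompactSupport (poisson F G) := by
  refine HasCompactSupport.intro hF.2 fun x hx => ?_
  rw [← poisson_eq, fderiv_of_notMem_tsupport ℝ hx]; rfl

theorem norm_pair {n : ℕ} (x y : Phase n) : ‖((x, 0) : CV n) - (y, 0)‖ = ‖x - y‖ := by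
  rw [Prod.mk_sub_mk, Prod.norm_mk, sub_self, norm_zero]; simp

theorem norm_pair' {n : ℕ} (x : Phase n) : ‖((x, 0) : CV n)‖ = ‖x‖ := by
  rw [Prod.norm_mk, norm_zero]; simp

set_option maxHeartbeats 1000000 in
theorem true_est {n : ℕ} {F G : Phase n → ℝ} (hF : SmoothCpt F) (hG : SmoothCpt G) {ε : ℝ} (hε : 0 < ε) :
    ∃ σ > 0, ∀ (p0 p1 q1 : Fin n → ℝ) (z : ℝ),
      fl F σ (fl G σ (fl F (-σ) (fl G (-σ) ((p0, 0), 0)))) = ((p1, q1), z) → ‖p1‖ ≤ σ →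
      - z ≤ σ ^ 2 * (poisson F G 0 + ε) := by
  obtain ⟨Λ, hΛ0, hΛ⟩ := lipc (poisson_cpt hF) (poisson_c1 hF hG)
  obtain ⟨κF, hκF0, hκF⟩ := fl_lip hF
  obtain ⟨κG, hκG0, hκG⟩ := fl_lip hG
  obtain ⟨LF, hLF0, hLF⟩ := fl_speed hF
  obtain ⟨LG, hLG0, hLG⟩ := fl_speed hG
  set C1 := Λ * Real.exp κF * (Real.exp κG * Real.exp κF) with hC1
  have hC10 : 0 ≤ C1 := by positivity
  set Q := n * (C1 + 1) * C1 + Λ * (C1 + 1 + 2 * LF + LG) with hQ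
  have hQ0 : 0 ≤ Q := by positivity
  set σ := min 1 (ε / (Q + 1)) with hσ
  have hσ0 : 0 < σ := by positivity
  have hσ1 : σ ≤ 1 := min_le_left _ _
  have hσ2 : σ * Q ≤ ε := by
    have : σ ≤ ε / (Q + 1) := min_le_right _ _
    rw [le_div_iff₀ (by positivity)] at this
    nlinarith
  refine ⟨σ, hσ0, fun p0 p1 q1 z hΨ hp1 => ?_⟩
  have gp := piece_gen hG hG (flE_isCT hF σ) (flE_isCT hF (-σ)) IsCT.one σ
  set K : ℝ → Phase n → ℝ := fun v => pull (flE hF σ * flE hG v) (fun x => G x - pull (flE hF (-σ)) G x) with hK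
  have hKeq : ∀ v x, K v x = Mf hF G σ (fl G (-v) (fl F (-σ) (x, 0))).1 := fun v x => rfl
  have hlipF : ∀ t, |t| ≤ 1 → ∀ a b, ‖fl F t a - fl F t b‖ ≤ Real.exp κF * ‖a - b‖ := fun t ht a b =>
    (hκF t a b).trans (by gcongr; nlinarith [abs_nonneg t])
  have hlipG : ∀ t, |t| ≤ 1 → ∀ a b, ‖fl G t a - fl G t b‖ ≤ Real.exp κG * ‖a - b‖ := fun t ht a b =>
    (hκG t a b).trans (by gcongr; nlinarith [abs_nonneg t])
  have hMlip : ∀ x y, |Mf hF G σ y - Mf hF G σ x| ≤ σ * (Λ * Real.exp κF) * ‖y - x‖ := by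
    intro x y
    have := mvt_norm (σ := σ) (C := Λ * (Real.exp κF * ‖y - x‖)) (a := 0) (b := σ)
      (fun t => (G_der hF hG (x, 0) t).sub (G_der hF hG (y, 0) t))
      (fun t h1 h2 => by
        have e : - poisson F G (fl F t (x, 0)).1 - - poisson F G (fl F t (y, 0)).1 =
          poisson F G (fl F t (y, 0)).1 - poisson F G (fl F t (x, 0)).1 := by ring
        rw [e]
        refine (hΛ _ _).trans ?_
        gcongr
        refine (norm_fst_le (fl F t (y, 0) - fl F t (x, 0))).trans ?_
        refine (hlipF t (by rw [abs_of_nonneg h1]; linarith) _ _).trans ?_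
        rw [norm_pair]) (by positivity) le_rfl hσ0.le hσ0.le le_rfl
    rw [Mf_eq, Mf_eq]
    simp only [Pi.sub_apply, Real.norm_eq_abs] at this
    refine (le_of_eq ?_).trans (this.trans (le_of_eq (by ring)))
    congr 1; ring
  have hKder : ∀ v, 0 ≤ v → v ≤ σ → ∀ x, ‖fderiv ℝ (K v) x‖ ≤ σ * C1 := by
    intro v h0 h1 x
    refine ((gp.kc v).differentiable (by norm_num) x).hasFDerivAt.le_of_lip'
        (by positivity) (Filter.Eventually.of_forall fun y => ?_)
    refine (hMlip _ _).trans ?_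
    rw [hC1]
    have hn : ‖((flE hF σ * flE hG v).symm (y, 0)).1 - ((flE hF σ * flE hG v).symm (x, 0)).1‖ ≤
        Real.exp κG * (Real.exp κF * ‖y - x‖) := by
      change ‖(fl G (-v) (fl F (-σ) (y, 0))).1 - (fl G (-v) (fl F (-σ) (x, 0))).1‖ ≤ _
      refine (norm_fst_le (fl G (-v) (fl F (-σ) (y, 0)) - fl G (-v) (fl F (-σ) (x, 0)))).trans ?_
      refine (hlipG (-v) (by rw [abs_neg, abs_of_nonneg h0]; linarith) _ _).trans ?_
      gcongr
      refine (hlipF (-σ) (by rw [abs_neg, abs_of_nonneg hσ0.le]; linarith) _ _).trans ?_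
      rw [norm_pair]
    calc _ ≤ σ * (Λ * Real.exp κF) * (Real.exp κG * (Real.exp κF * ‖y - x‖)) := by gcongr
      _ = _ := by ring
  have hKle : ∀ v, 0 ≤ v → v ≤ σ → ∀ x, K v x ≤ σ * (poisson F G 0 + Λ * (‖x‖ + (2 * LF + LG) * σ)) := by
    intro v h0 h1 x
    rw [hKeq]
    refine Mf_le hF hG hσ0.le _ fun t t0 t1 => ?_
    set u := (fl G (-v) (fl F (-σ) (x, 0))).1 with hu
    have a1 := hLF (-σ) (x, 0)
    have a2 := hLG (-v) (fl F (-σ) (x, 0))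
    have a3 := hLF t (u, 0)
    rw [abs_neg, abs_of_nonneg hσ0.le] at a1
    rw [abs_neg, abs_of_nonneg h0] at a2
    rw [abs_of_nonneg t0] at a3
    have b1 : ‖fl F (-σ) (x, 0)‖ ≤ ‖x‖ + LF * σ := by
      have := norm_le_norm_add_norm_sub' (fl F (-σ) (x, 0)) (x, 0)
      rw [norm_pair'] at this; linarith
    have b2 : ‖u‖ ≤ ‖x‖ + LF * σ + LG * σ := by
      have := norm_le_norm_add_norm_sub' (fl G (-v) (fl F (-σ) (x, 0))) (fl F (-σ) (x, 0))
      have c := norm_fst_le (fl G (-v) (fl F (-σ) (x, 0)))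
      have d : LG * v ≤ LG * σ := by gcongr
      linarith
    have b3 : ‖(fl F t (u, 0)).1‖ ≤ ‖x‖ + (2 * LF + LG) * σ := by
      have := norm_le_norm_add_norm_sub' (fl F t (u, 0)) (u, 0)
      have c := norm_fst_le (fl F t (u, 0))
      rw [norm_pair'] at this
      have d : LF * t ≤ LF * σ := by gcongr
      linarith
    have b4 := hΛ (fl F t (u, 0)).1 0
    rw [sub_zero] at b4
    have b5 := (le_abs_self _).trans b4
    have b6 : Λ * ‖(fl F t (u, 0)).1‖ ≤ Λ * (‖x‖ + (2 * LF + LG) * σ) := by gcongr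
    linarith
  set y : ℝ → CV n := fun v => fl F σ (fl G v (fl F (-σ) (fl G (-v) ((p0, 0), 0)))) with hy
  have hyd : ∀ v, HasDerivAt y (ell (K v) (y v).1) v := fun v => gp.der v ((p0, 0), 0)
  have hy0 : y 0 = ((p0, 0), 0) := by
    simp only [hy, neg_zero, fl_zero hG, ← fl_add hF, add_neg_cancel, fl_zero hF]
  have hyσ : y σ = ((p1, q1), z) := hΨ
  have hp : ∀ v, 0 ≤ v → v ≤ σ → ‖(y v).1.1‖ ≤ (C1 + 1) * σ := by
    intro v h0 h1
    have := mvt_norm (σ := σ) (C := σ * C1) (a := σ) (b := v) (fun t => hd_fst (hd_fst (hyd t)))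
      (fun t t0 t1 => by
        simp only [ell, norm_neg]
        exact (norm_dQ_le _ _).trans (hKder t t0 t1 _)) (by positivity) hσ0.le le_rfl h0 h1
    have c := norm_le_norm_add_norm_sub' (y v).1.1 (y σ).1.1
    rw [hyσ] at c this
    simp only [] at c this
    have : σ * C1 * σ ≤ C1 * σ := by nlinarith [mul_nonneg hC10 hσ0.le]
    linarith
  have hq : ∀ v, 0 ≤ v → v ≤ σ → ‖(y v).1.2‖ ≤ (C1 + 1) * σ := by
    intro v h0 h1
    have := mvt_norm (σ := σ) (C := σ * C1) (a := 0) (b := v) (fun t => hd_snd (hd_fst (hyd t)))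
      (fun t t0 t1 => by
        simp only [ell]
        exact (norm_dP_le _ _).trans (hKder t t0 t1 _)) (by positivity) le_rfl hσ0.le h0 h1
    rw [hy0] at this
    simp only [sub_zero] at this
    have : σ * C1 * σ ≤ C1 * σ := by nlinarith [mul_nonneg hC10 hσ0.le]
    linarith
  have hzz := mvt_le (σ := σ) (C := σ * (poisson F G 0 + ε)) hσ0.le (fun t => (hd_snd (hyd t)).neg)
    (fun t t0 t1 => by
      have hx : ‖(y t).1‖ ≤ (C1 + 1) * σ := max_le (hp t t0 t1) (hq t t0 t1)
      have a1 := hKle t t0 t1 (y t).1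
      have a2 := abs_dot_le (y t).1.1 (dP (K t) (y t).1)
      have a3 : n * ‖(y t).1.1‖ * ‖dP (K t) (y t).1‖ ≤ n * ((C1 + 1) * σ) * (σ * C1) := by
        gcongr
        · exact hp t t0 t1
        · exact (norm_dP_le _ _).trans (hKder t t0 t1 _)
      have a4 := (neg_abs_le ((y t).1.1 ⬝ᵥ dP (K t) (y t).1))
      have a5 : σ * (poisson F G 0 + Λ * (‖(y t).1‖ + (2 * LF + LG) * σ)) ≤
          σ * (poisson F G 0 + Λ * ((C1 + 1) * σ + (2 * LF + LG) * σ)) := by gcongr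
      have a6 : n * ((C1 + 1) * σ) * (σ * C1) + σ * (poisson F G 0 + Λ * ((C1 + 1) * σ + (2 * LF + LG) * σ)) =
          σ * (poisson F G 0 + σ * Q) := by rw [hQ]; ring
      have a7 : σ * (poisson F G 0 + σ * Q) ≤ σ * (poisson F G 0 + ε) := by gcongr
      simp only [ell]
      linarith)
  simp only [Pi.neg_apply, hy0, hyσ] at hzz
  linarith

/-- data of one piece of the comparison path -/
structure Piece (n : ℕ) where
  H : Phase n → ℝ
  H' : Phase n → ℝ
  C : Equiv.Perm (CV n)
  B : Equiv.Perm (CV n)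
  D : Equiv.Perm (CV n)
  hH : SmoothCpt H
  hH' : SmoothCpt H'
  hC : IsCT C
  hB : IsCT B
  hD : IsCT D

/-- the six pieces -/
noncomputable def pcs {n : ℕ} {F G F' G' : Phase n → ℝ} (hF : SmoothCpt F) (hG : SmoothCpt G)
    (hF' : SmoothCpt F') (hG' : SmoothCpt G') (σ : ℝ) : ℕ → Piece n
  | 0 => ⟨G', G', flE hF' σ, flE hF' (-σ), 1, hG', hG', flE_isCT _ _, flE_isCT _ _, IsCT.one⟩
  | 1 => ⟨F, F', 1, 1, flE hF' σ * (flE hG' σ * (flE hF' (-σ) * flE hG' (-σ))), hF, hF', IsCT.one, IsCT.one,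
      (flE_isCT _ _).mul ((flE_isCT _ _).mul ((flE_isCT _ _).mul (flE_isCT _ _)))⟩
  | 2 => ⟨G, G', flE hF σ, 1, flE hG' σ * (flE hF' (-σ) * flE hG' (-σ)), hG, hG', flE_isCT _ _, IsCT.one,
      ((flE_isCT _ _).mul ((flE_isCT _ _).mul (flE_isCT _ _)))⟩
  | 3 => ⟨fun x => - F x, fun x => - F' x, flE hF σ * flE hG σ, 1, flE hF' (-σ) * flE hG' (-σ), hF.neg, hF'.neg,
      (flE_isCT _ _).mul (flE_isCT _ _), IsCT.one, (flE_isCT _ _).mul (flE_isCT _ _)⟩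
  | 4 => ⟨fun x => - G x, fun x => - G' x, flE hF σ * (flE hG σ * flE hF (-σ)), 1, flE hG' (-σ), hG.neg, hG'.neg,
      (flE_isCT _ _).mul ((flE_isCT _ _).mul (flE_isCT _ _)), IsCT.one, flE_isCT _ _⟩
  | _ + 5 => ⟨F, F, 1, 1, flE hF σ * (flE hG σ * (flE hF (-σ) * flE hG (-σ))), hF, hF, IsCT.one, IsCT.one,
      (flE_isCT _ _).mul ((flE_isCT _ _).mul ((flE_isCT _ _).mul (flE_isCT _ _)))⟩

theorem mul_symm_ap {α : Type*} (a b : Equiv.Perm α) (x : α) : (a * b).symm x = b.symm (a.symm x) := rfl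
theorem one_symm_ap {α : Type*} (x : α) : (1 : Equiv.Perm α).symm x = x := rfl
theorem fl_can {n : ℕ} {H : Phase n → ℝ} (hH : SmoothCpt H) (t : ℝ) (w : CV n) : fl H (-t) (fl H t w) = w := by
  rw [← fl_add hH]; simp [fl_zero hH]
theorem fl_can' {n : ℕ} {H : Phase n → ℝ} (hH : SmoothCpt H) (t : ℝ) (w : CV n) : fl H t (fl H (-t) w) = w := by
  rw [← fl_add hH]; simp [fl_zero hH]

theorem centered {n : ℕ} {F G : Phase n → ℝ} (hF : SmoothCpt F) (hG : SmoothCpt G) {ε : ℝ} (hε : 0 < ε) :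
    ∃ δ > 0, ∀ F' G' : Phase n → ℝ, SmoothCpt F' → SmoothCpt G' → (∀ x, |F' x - F x| ≤ δ) →
      (∀ x, |G' x - G x| ≤ δ) → ∃ x, poisson F' G' x < poisson F G 0 + ε := by
  obtain ⟨σ, hσ, hest⟩ := true_est hF hG (half_pos hε)
  refine ⟨σ * ε / 32, by positivity, fun F' G' hF' hG' hFF hGG => ?_⟩
  by_contra! hcon
  set β := poisson F G 0 + ε with hβ
  set δ := σ * ε / 32 with hδ
  have hδ0 : 0 < δ := by positivity
  obtain ⟨Λ, hΛ0, hΛ⟩ := ((flE_isCT hF σ).mul ((flE_isCT hG σ).mul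
    ((flE_isCT hF (-σ)).mul (flE_isCT hG (-σ))))).lip
  obtain ⟨η, hη, hη1, hη2⟩ : ∃ η > 0, (1 + Λ) * η ≤ σ ∧ (1 + Λ) * η ≤ σ ^ 2 * ε / 8 := by
    refine ⟨min σ (σ ^ 2 * ε / 8) / (1 + Λ), by positivity, ?_, ?_⟩
    · rw [mul_div_cancel₀ _ (by positivity)]; exact min_le_left _ _
    · rw [mul_div_cancel₀ _ (by positivity)]; exact min_le_right _ _
  let p := pcs hF hG hF' hG' σ
  let κ : ℕ → ℝ := fun k => if k = 0 then - (σ * β) else δ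
  have hgen := fun k => piece_gen (p k).hH (p k).hH' (p k).hC (p k).hB (p k).hD σ
  have hchain := chain (m := 5) (by norm_num) hσ hgen (κ := κ) (ε := η)
  specialize hchain ?_ ?_ ?_ hη
  · intro w
    simp only [p, pcs, neg_zero, fl_zero hG', one_symm_ap, flE_symm, neg_neg]
    exact fl_can' hF' _ _
  · intro k hk w
    interval_cases k <;>
    simp only [p, pcs, neg_zero, fl_zero hG', fl_zero hF', fl_zero hF, fl_zero hG, fl_zero hF.neg, fl_zero hG.neg, fl_zero hF'.neg,
      fl_zero hG'.neg, one_symm_ap, mul_symm_ap, flE_symm, neg_neg, fl_neg hF, fl_neg hG, fl_neg hF', fl_neg hG',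
      fl_can hF, fl_can hG, fl_can hF', fl_can hG', fl_can' hF, fl_can' hG, fl_can' hF', fl_can' hG']
  · intro k v x _ _
    have k1 : ∀ y, -δ ≤ F y - F' y := fun y => by linarith [(abs_le.1 (hFF y)).2]
    have k2 : ∀ y, -δ ≤ G y - G' y := fun y => by linarith [(abs_le.1 (hGG y)).2]
    have k3 : ∀ y, -δ ≤ - F y - - F' y := fun y => by linarith [(abs_le.1 (hFF y)).1]
    have k4 : ∀ y, -δ ≤ - G y - - G' y := fun y => by linarith [(abs_le.1 (hGG y)).1]
    have k5 : ∀ y, -δ ≤ F y - F y := fun y => by linarith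
    match k with
    | 0 =>
      simp only [κ, if_true, neg_neg]
      exact Mf_ge hF' hG' hσ.le _ hcon
    | 1 => exact k1 (((1 : Equiv.Perm (CV n)) * flE hF v).symm (x, 0)).1
    | 2 => exact k2 ((flE hF σ * flE hG v).symm (x, 0)).1
    | 3 => exact k3 ((flE hF σ * flE hG σ * flE hF.neg v).symm (x, 0)).1
    | 4 => exact k4 ((flE hF σ * (flE hG σ * flE hF (-σ)) * flE hG.neg v).symm (x, 0)).1
    | k + 5 => exact k5 (((1 : Equiv.Perm (CV n)) * flE hF v).symm (x, 0)).1
  obtain ⟨p0, p1, q1, z, h1, h2, h3⟩ := hchain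
  have e2 : ∑ k ∈ Finset.range 5, κ k = - (σ * β) + 4 * δ := by
    simp [Finset.sum_range_succ, κ]; ring
  rw [e2] at h2
  set Ψ := flE hF σ * (flE hG σ * (flE hF (-σ) * flE hG (-σ))) with hΨ
  have h4 : ‖Ψ.symm ((p1, q1), z) - ((p0, 0), 0)‖ ≤ η := by
    refine le_trans (le_of_eq ?_) h3
    congr 2
    simp only [p, pcs, neg_zero, fl_zero hF, one_symm_ap]
    rfl
  have h5 : ‖Ψ ((p0, 0), 0) - ((p1, q1), z)‖ ≤ Λ * η := by
    have := hΛ ((p0, 0), 0) (Ψ.symm ((p1, q1), z))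
    rw [Equiv.apply_symm_apply, norm_sub_rev _ (Ψ.symm _)] at this
    exact this.trans (by gcongr)
  obtain ⟨⟨⟨p2, q2⟩, z2⟩, hw⟩ : ∃ w, w = Ψ ((p0, 0), 0) := ⟨_, rfl⟩
  rw [← hw] at h5
  have h6 : ‖p2 - p1‖ ≤ Λ * η := (norm_fst_le _).trans ((norm_fst_le _).trans h5)
  have h7 : ‖z2 - z‖ ≤ Λ * η := (norm_snd_le _).trans h5
  have h8 : ‖p2‖ ≤ σ := by
    have : ‖p2‖ ≤ ‖p2 - p1‖ + ‖p1‖ := by simpa using norm_add_le (p2 - p1) p1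
    linarith
  have h9 := hest p0 p2 q2 z2 hw.symm h8
  have h10 := (abs_le.1 h7).2
  have e3 : poisson F G 0 + ε / 2 = β - ε / 2 := by rw [hβ]; ring
  rw [e3] at h9
  have : σ * (4 * δ) = σ ^ 2 * ε / 8 := by rw [hδ]; ring
  have : 0 < σ ^ 2 * ε := by positivity
  nlinarith

theorem SmoothCpt.trans {n : ℕ} {F : Phase n → ℝ} (hF : SmoothCpt F) (a : Phase n) :
    SmoothCpt (fun x => F (x + a)) :=
  ⟨hF.1.comp (contDiff_id.add contDiff_const), hF.2.comp_homeomorph (Homeomorph.addRight a)⟩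

theorem poisson_trans {n : ℕ} (F G : Phase n → ℝ) (a x : Phase n) :
    poisson (fun x => F (x + a)) (fun x => G (x + a)) x = poisson F G (x + a) := by
  simp only [poisson, pderivP, pderivQ, fderiv_comp_add_right]

theorem le_unif {n : ℕ} {F G : Phase n → ℝ} (hF : SmoothCpt F) (hG : SmoothCpt G) (x : Phase n) :
    |F x - G x| ≤ unif (fun x => F x - G x) := by
  obtain ⟨a, ha⟩ := hF.2.exists_bound_of_continuous hF.1.continuous
  obtain ⟨b, hb⟩ := hG.2.exists_bound_of_continuous hG.1.continuous
  refine le_ciSup (f := fun x => |F x - G x|) ⟨a + b, ?_⟩ x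
  rintro _ ⟨y, rfl⟩
  exact (norm_sub_le (F y) (G y)).trans (add_le_add (ha y) (hb y))

/-- Upper semicontinuity of `min {F,G}` (equivalently lower semicontinuity of
`−min {F,G}`): for every `ε > 0` there is `δ > 0` such that any `F', G' ∈ C_c^∞(ℝ^{2n})`
that are `δ`-close to `F, G` in the uniform norm satisfy `min {F',G'} < min {F,G} + ε`. -/
theorem min_poisson_upper_semicontinuous (n : ℕ) (hn : 1 ≤ n) (F G : Phase n → ℝ)
    (hF : SmoothCpt F) (hG : SmoothCpt G) :
    ∀ ε > (0 : ℝ), ∃ δ > (0 : ℝ), ∀ F' G' : Phase n → ℝ,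
      SmoothCpt F' → SmoothCpt G' →
      unif (fun x => F' x - F x) < δ → unif (fun x => G' x - G x) < δ →
      (⨅ x, poisson F' G' x) < (⨅ x, poisson F G x) + ε := by
  intro ε hε
  obtain ⟨x0, hx0⟩ := exists_lt_of_ciInf_lt (f := poisson F G)
    (a := (⨅ x, poisson F G x) + ε / 2) (by linarith)
  obtain ⟨δ, hδ, h⟩ := centered (hF.trans x0) (hG.trans x0) (half_pos hε)
  refine ⟨δ, hδ, fun F' G' hF' hG' h1 h2 => ?_⟩
  obtain ⟨x, hx⟩ := h _ _ (hF'.trans x0) (hG'.trans x0)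
    (fun x => (le_unif hF' hF _).trans h1.le) (fun x => (le_unif hG' hG _).trans h2.le)
  rw [poisson_trans, poisson_trans, zero_add] at hx
  obtain ⟨b, hb⟩ := (poisson_cpt (G := G') hF').exists_bound_of_continuous (poisson_c1 hF' hG').continuous
  have h3 : (⨅ x, poisson F' G' x) ≤ poisson F' G' (x + x0) := by
    refine ciInf_le ⟨-b, ?_⟩ _
    rintro _ ⟨y, rfl⟩
    exact (abs_le.1 (hb y)).1
  linarith
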